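/- Let F be a finite field with q elements. For n ≥ 0 let c_n be the number of pairs (B,C) ∈ M_n(F)² with BC = CB, and let g_n = |GL_n(F)| = ∏_{i=0}^{n−1}(q^n − q^i) (with g_0 = 1). Then for every real number t with 0 ≤ t < q^{−2}: the series ∑_{n=0}^{∞} (c_n/g_n) t^n converges, the double product ∏_{m=1}^{∞} ∏_{j=0}^{∞} (1 − q^{1−j} t^m)^{−1} converges, and the two are equal. -/

import Mathlib

open Matrix

/-- `c_n`: the number of commuting pairs of `n×n` matrices over `F`. -/
noncomputable def ccount (F : Type*) [Field F] [Fintype F] (n : ℕ) : ℕ :=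
  Nat.card {p : Matrix (Fin n) (Fin n) F × Matrix (Fin n) (Fin n) F //
    p.1 * p.2 = p.2 * p.1}

/-- `g_n = |GL_n(F)| = ∏_{i=0}^{n−1}(qⁿ − qⁱ)` as a real number. -/
noncomputable def glOrder (q : ℕ) (n : ℕ) : ℝ :=
  ∏ i ∈ Finset.range n, ((q : ℝ) ^ n - (q : ℝ) ^ i)

open scoped ENNReal NNReal

section FunctionalEquation

theorem ENNReal.tsum_tsum_eq_tsum_tsum_add (b : ℕ → ℕ → ℝ≥0∞) (hb : ∀ n r, n < r → b n r = 0) :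
    ∑' n, ∑' r, b n r = ∑' n, ∑' r, b (n + r) r := by
  rw [ENNReal.tsum_comm, ENNReal.tsum_comm (f := fun n r => b (n + r) r)]
  refine tsum_congr fun r => ?_
  have h := (ENNReal.summable (f := fun n => b (n + r) r)).sum_add_tsum_nat_add' (f := fun n => b n r)
  rw [← h, Finset.sum_eq_zero fun n hn => hb n r (Finset.mem_range.1 hn), zero_add]

theorem ENNReal.tsum_sum_antidiagonal_mul (f g : ℕ → ℝ≥0∞) :
    ∑' r, ∑ p ∈ Finset.HasAntidiagonal.antidiagonal r, f p.1 * g p.2 = (∑' n, f n) * ∑' n, g n := by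
  have h : ∀ r, ∑ p ∈ Finset.HasAntidiagonal.antidiagonal r, f p.1 * g p.2 =
      ∑' p : Finset.HasAntidiagonal.antidiagonal r, f p.1.1 * g p.1.2 := fun r => by
    rw [tsum_fintype, Finset.sum_coe_sort (Finset.HasAntidiagonal.antidiagonal r) (fun p => f p.1 * g p.2)]
  simp_rw [h, ← ENNReal.tsum_mul_right, ← ENNReal.tsum_mul_left]
  rw [← ENNReal.tsum_sigma, ← ENNReal.tsum_prod,
    ← Finset.HasAntidiagonal.sigmaAntidiagonalEquivProd.tsum_eq]
  rfl

/-- The bivariate generating function of `a`, with values in `[0, ∞]`. -/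
noncomputable def genFun (a : ℕ → ℕ → ℝ≥0) (t u : ℝ≥0∞) : ℝ≥0∞ :=
  ∑' n, ∑' r, (a n r : ℝ≥0∞) * t ^ n * u ^ r

theorem tsum_conv_eq_genFun_mul (a : ℕ → ℕ → ℝ≥0) (e : ℕ → ℝ≥0) (t u : ℝ≥0∞) :
    ∑' n, ∑' r, ((∑ p ∈ Finset.HasAntidiagonal.antidiagonal r, a n p.1 * e p.2 : ℝ≥0) : ℝ≥0∞) *
      t ^ (n + r) * u ^ r = genFun a t (t * u) * ∑' m, (e m : ℝ≥0∞) * (t * u) ^ m := by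
  rw [genFun, ← ENNReal.tsum_mul_right]
  refine tsum_congr fun n => ?_
  rw [← ENNReal.tsum_sum_antidiagonal_mul]
  refine tsum_congr fun r => ?_
  push_cast
  rw [Finset.sum_mul, Finset.sum_mul]
  refine Finset.sum_congr rfl fun p hp => ?_
  rw [← Finset.HasAntidiagonal.mem_antidiagonal.1 hp]
  ring

theorem genFun_eq_shift (a : ℕ → ℕ → ℝ≥0) (ha : ∀ n r, n < r → a n r = 0) (t u : ℝ≥0∞) :
    genFun a t u = ∑' n, ∑' r, (a (n + r) r : ℝ≥0∞) * t ^ (n + r) * u ^ r :=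
  ENNReal.tsum_tsum_eq_tsum_tsum_add _ fun n r h => by simp [ha n r h]

theorem genFun_le_of_conv {a : ℕ → ℕ → ℝ≥0} {e : ℕ → ℝ≥0} (ha : ∀ n r, n < r → a n r = 0)
    (hrec : ∀ n r, a (n + r) r ≤ ∑ p ∈ Finset.HasAntidiagonal.antidiagonal r, a n p.1 * e p.2) (t u : ℝ≥0∞) :
    genFun a t u ≤ genFun a t (t * u) * ∑' m, (e m : ℝ≥0∞) * (t * u) ^ m := by
  rw [← tsum_conv_eq_genFun_mul, genFun_eq_shift a ha]
  gcongr with n r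
  exact hrec n r

theorem genFun_eq_of_conv {a : ℕ → ℕ → ℝ≥0} {e : ℕ → ℝ≥0} (ha : ∀ n r, n < r → a n r = 0)
    (hrec : ∀ n r, a (n + r) r = ∑ p ∈ Finset.HasAntidiagonal.antidiagonal r, a n p.1 * e p.2) (t u : ℝ≥0∞) :
    genFun a t u = genFun a t (t * u) * ∑' m, (e m : ℝ≥0∞) * (t * u) ^ m := by
  rw [← tsum_conv_eq_genFun_mul, genFun_eq_shift a ha]
  simp_rw [hrec]

theorem genFun_le_iterate {a : ℕ → ℕ → ℝ≥0} {e : ℕ → ℝ≥0} (ha : ∀ n r, n < r → a n r = 0)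
    (hrec : ∀ n r, a (n + r) r ≤ ∑ p ∈ Finset.HasAntidiagonal.antidiagonal r, a n p.1 * e p.2) (t : ℝ≥0∞)
    (k : ℕ) : genFun a t 1 ≤
      genFun a t (t ^ k) * ∏ i ∈ Finset.range k, ∑' m, (e m : ℝ≥0∞) * (t ^ (i + 1)) ^ m := by
  induction k with
  | zero => simp
  | succ k ih =>
    refine ih.trans ?_
    rw [Finset.prod_range_succ, mul_comm (∏ i ∈ Finset.range k, _), ← mul_assoc]
    gcongr
    rw [pow_succ' t k]
    exact genFun_le_of_conv ha hrec t (t ^ k)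

theorem genFun_eq_iterate {a : ℕ → ℕ → ℝ≥0} {e : ℕ → ℝ≥0} (ha : ∀ n r, n < r → a n r = 0)
    (hrec : ∀ n r, a (n + r) r = ∑ p ∈ Finset.HasAntidiagonal.antidiagonal r, a n p.1 * e p.2) (t : ℝ≥0∞)
    (k : ℕ) : genFun a t 1 =
      genFun a t (t ^ k) * ∏ i ∈ Finset.range k, ∑' m, (e m : ℝ≥0∞) * (t ^ (i + 1)) ^ m := by
  induction k with
  | zero => simp
  | succ k ih =>
    rw [ih, Finset.prod_range_succ, mul_comm (∏ i ∈ Finset.range k, _), ← mul_assoc,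
      pow_succ' t k, ← genFun_eq_of_conv ha hrec t (t ^ k)]

theorem genFun_zero_right (a : ℕ → ℕ → ℝ≥0) (t : ℝ≥0∞) :
    genFun a t 0 = ∑' n, (a n 0 : ℝ≥0∞) * t ^ n := by
  refine tsum_congr fun n => ?_
  rw [tsum_eq_single 0 fun r hr => by simp [hr]]
  simp

theorem genFun_zero_le (a : ℕ → ℕ → ℝ≥0) (t u : ℝ≥0∞) : genFun a t 0 ≤ genFun a t u := by
  unfold genFun
  gcongr
  exact zero_le

theorem genFun_le_add (a : ℕ → ℕ → ℝ≥0) (t : ℝ≥0∞) {u : ℝ≥0∞} (hu : u ≤ 1) :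
    genFun a t u ≤ genFun a t 0 + u * genFun a t 1 := by
  unfold genFun
  rw [← ENNReal.tsum_mul_left, ← ENNReal.tsum_add]
  refine ENNReal.tsum_le_tsum fun n => ?_
  rw [← ENNReal.tsum_mul_left, ← ENNReal.tsum_add]
  refine ENNReal.tsum_le_tsum fun r => ?_
  rcases r with _ | r
  · simp
  · have : u ^ (r + 1) ≤ u := by
      simpa using pow_le_pow_right_of_le_one' hu (Nat.le_add_left 1 r)
    calc _ ≤ (a n (r + 1) : ℝ≥0∞) * t ^ n * u := by gcongr
      _ = _ := by simp [mul_comm]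

/-- If every finite product is at most `P` and `genFun a t 1` is finite, then iterating the
functional inequality bounds it. -/
theorem genFun_le_mul {a : ℕ → ℕ → ℝ≥0} {e : ℕ → ℝ≥0} (ha : ∀ n r, n < r → a n r = 0)
    (hrec : ∀ n r, a (n + r) r ≤ ∑ p ∈ Finset.HasAntidiagonal.antidiagonal r, a n p.1 * e p.2) {t : ℝ≥0}
    (ht : t < 1) {P : ℝ≥0∞} (hP : P ≠ ∞)
    (hprod : ∀ k, ∏ i ∈ Finset.range k, ∑' m, (e m : ℝ≥0∞) * ((t : ℝ≥0∞) ^ (i + 1)) ^ m ≤ P)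
    (hfin : genFun a t 1 ≠ ∞) : genFun a t 1 ≤ genFun a t 0 * P := by
  have h1 : ∀ k : ℕ, genFun a t 1 ≤
      (genFun a t 0 + (t : ℝ≥0∞) ^ k * genFun a t 1) * P := fun k =>
    (genFun_le_iterate ha hrec t k).trans
      (mul_le_mul' (genFun_le_add a t (pow_le_one' (by exact_mod_cast ht.le) k)) (hprod k))
  have h2 : Filter.Tendsto (fun k : ℕ => (genFun a t 0 + (t : ℝ≥0∞) ^ k * genFun a t 1) * P)
      Filter.atTop (nhds ((genFun a t 0 + 0 * genFun a t 1) * P)) := by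
    refine ENNReal.Tendsto.mul_const (Filter.Tendsto.const_add _ ?_) (Or.inr hP)
    exact ENNReal.Tendsto.mul_const
      (ENNReal.tendsto_pow_atTop_nhds_zero_of_lt_one (by exact_mod_cast ht)) (Or.inr hfin)
  simpa using ge_of_tendsto' h2 h1

theorem genFun_truncate_ne_top {a : ℕ → ℕ → ℝ≥0} (ha : ∀ n r, n < r → a n r = 0) (t : ℝ≥0)
    (N : ℕ) : genFun (fun n r => if n < N then a n r else 0) t 1 ≠ ∞ := by
  unfold genFun
  rw [tsum_eq_sum (s := Finset.range N) fun n hn => by simp_all]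
  refine ENNReal.sum_ne_top.2 fun n _ => ?_
  rw [tsum_eq_sum (s := Finset.range (n + 1)) fun r hr => by
    simp [ha n r (by rw [Finset.mem_range] at hr; omega)]]
  refine ENNReal.sum_ne_top.2 fun r _ => ?_
  simp only [one_pow, mul_one]
  exact ENNReal.mul_ne_top ENNReal.coe_ne_top (ENNReal.pow_ne_top ENNReal.coe_ne_top)

theorem genFun_eq_iSup_truncate (a : ℕ → ℕ → ℝ≥0) (t u : ℝ≥0∞) :
    genFun a t u = ⨆ N, genFun (fun n r => if n < N then a n r else 0) t u := by
  have : ∀ N, genFun (fun n r => if n < N then a n r else 0) t u =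
      ∑ n ∈ Finset.range N, ∑' r, (a n r : ℝ≥0∞) * t ^ n * u ^ r := fun N => by
    unfold genFun
    rw [tsum_eq_sum (s := Finset.range N) fun n hn => by simp_all]
    refine Finset.sum_congr rfl fun n hn => ?_
    simp [Finset.mem_range.1 hn]
  simp_rw [this]
  exact ENNReal.tsum_eq_iSup_nat

theorem genFun_one_eq {a : ℕ → ℕ → ℝ≥0} {e : ℕ → ℝ≥0} (ha : ∀ n r, n < r → a n r = 0)
    (hrec : ∀ n r, a (n + r) r = ∑ p ∈ Finset.HasAntidiagonal.antidiagonal r, a n p.1 * e p.2) {t : ℝ≥0}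
    (ht : t < 1) {P : ℝ≥0∞} (hP : P ≠ ∞) (hP0 : P ≠ 0)
    (hprod : ∀ k, ∏ i ∈ Finset.range k, ∑' m, (e m : ℝ≥0∞) * ((t : ℝ≥0∞) ^ (i + 1)) ^ m ≤ P)
    (hlim : Filter.Tendsto (fun k => ∏ i ∈ Finset.range k,
      ∑' m, (e m : ℝ≥0∞) * ((t : ℝ≥0∞) ^ (i + 1)) ^ m) Filter.atTop (nhds P)) :
    genFun a t 1 = genFun a t 0 * P := by
  apply le_antisymm
  · rw [genFun_eq_iSup_truncate]
    refine iSup_le fun N => ?_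
    refine (genFun_le_mul (e := e) (fun n r h => by simp [ha n r h]) (fun n r => ?_) ht hP hprod
      (genFun_truncate_ne_top ha t N)).trans ?_
    · split_ifs with h1 h2 h2
      · exact (hrec n r).le
      · omega
      · exact zero_le
      · simp
    · gcongr
      rw [genFun_eq_iSup_truncate a]
      exact le_iSup (fun N => genFun (fun n r => if n < N then a n r else 0) (t : ℝ≥0∞) 0) N
  · have h2 := ENNReal.Tendsto.const_mul (a := genFun a t 0) hlim (Or.inl hP0)
    refine le_of_tendsto' h2 fun k => ?_
    rw [genFun_eq_iterate ha hrec t k]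
    gcongr
    exact genFun_zero_le _ _ _

theorem multipliable_tsum_pow {e : ℕ → ℝ≥0} (he0 : e 0 = 1) {t : ℝ≥0} (ht : t < 1)
    (hs : ∀ i : ℕ, Summable fun m => e m * (t ^ (i + 1)) ^ m) :
    Multipliable (fun i : ℕ => ∑' m, e m * (t ^ (i + 1)) ^ m) := by
  have hs' : ∀ i, Summable fun m => e (m + 1) * (t ^ (i + 1)) ^ (m + 1) := fun i =>
    (NNReal.summable_nat_add_iff 1).2 (hs i)
  have hsplit : ∀ i, ∑' m, e m * (t ^ (i + 1)) ^ m =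
      1 + ∑' m, e (m + 1) * (t ^ (i + 1)) ^ (m + 1) := fun i => by
    simpa [he0] using
      ((hs' i).hasSum.zero_add (f := fun m => e m * (t ^ (i + 1)) ^ m)).tsum_eq
  have hbound : ∀ i, ∑' m, e (m + 1) * (t ^ (i + 1)) ^ (m + 1) ≤
      t ^ i * ∑' m, e (m + 1) * (t ^ (0 + 1)) ^ (m + 1) := fun i => by
    rw [← NNReal.tsum_mul_left]
    refine (hs' i).tsum_le_tsum (fun m => ?_) ((hs' 0).mul_left _)
    calc e (m + 1) * (t ^ (i + 1)) ^ (m + 1)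
        = e (m + 1) * ((t ^ i) ^ m * t ^ i * t ^ (m + 1)) := by ring
      _ ≤ e (m + 1) * (1 * t ^ i * t ^ (m + 1)) := by
        gcongr
        exact pow_le_one' (pow_le_one' ht.le i) m
      _ = _ := by ring
  have hsum : Summable fun i => ∑' m, e (m + 1) * (t ^ (i + 1)) ^ (m + 1) :=
    NNReal.summable_of_le hbound ((NNReal.summable_geometric ht).mul_right _)
  have hreal := Real.multipliable_one_add_of_summable (NNReal.summable_coe.2 hsum)
  have hge : (0 : ℝ) ≤ ∏' i, (1 + ((∑' m, e (m + 1) * (t ^ (i + 1)) ^ (m + 1) : ℝ≥0) : ℝ)) :=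
    ge_of_tendsto' hreal.hasProd fun s => by positivity
  have hprod := hreal.hasProd
  lift ∏' i, (1 + ((∑' m, e (m + 1) * (t ^ (i + 1)) ^ (m + 1) : ℝ≥0) : ℝ)) to ℝ≥0
    using hge with P
  refine ⟨P, ?_⟩
  unfold HasProd at hprod ⊢
  rw [← NNReal.tendsto_coe]
  simpa [hsplit] using hprod

/-- A bivariate family whose generating function satisfies `A(u) = A(tu) G(tu)` has
`A(1) = A(0) ∏ G(tⁱ)`. -/
theorem hasSum_of_conv {a : ℕ → ℕ → ℝ≥0} {e : ℕ → ℝ≥0} (ha : ∀ n r, n < r → a n r = 0)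
    (hrec : ∀ n r, a (n + r) r =
      ∑ p ∈ Finset.HasAntidiagonal.antidiagonal r, a n p.1 * e p.2) (he0 : e 0 = 1)
    {t : ℝ≥0} (ht : t < 1) (hs : ∀ i : ℕ, Summable fun m => e m * (t ^ (i + 1)) ^ m)
    {A₀ : ℝ≥0} (hA : HasSum (fun n => a n 0 * t ^ n) A₀) :
    HasSum (fun n => (∑ r ∈ Finset.range (n + 1), a n r) * t ^ n)
      (A₀ * ∏' i : ℕ, ∑' m, e m * (t ^ (i + 1)) ^ m) := by
  have hm := multipliable_tsum_pow he0 ht hs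
  set G : ℕ → ℝ≥0 := fun i => ∑' m, e m * (t ^ (i + 1)) ^ m with hG
  have hG1 : ∀ i, 1 ≤ G i := fun i => by
    simpa [he0] using (hs i).le_tsum 0 fun _ _ => zero_le
  have hGE : ∀ i, ∑' m, (e m : ℝ≥0∞) * ((t : ℝ≥0∞) ^ (i + 1)) ^ m = (G i : ℝ≥0∞) := fun i => by
    rw [hG, ENNReal.coe_tsum (hs i)]
    push_cast
    rfl
  have hmono : Monotone fun k => ∏ i ∈ Finset.range k, G i := monotone_nat_of_le_succ fun k => by
    rw [Finset.prod_range_succ]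
    exact le_mul_of_one_le_right zero_le (hG1 k)
  have hlim := hm.hasProd.tendsto_prod_nat
  have hle : ∀ k, ∏ i ∈ Finset.range k, G i ≤ ∏' i, G i := hmono.ge_of_tendsto hlim
  have hP0 : ∏' i, G i ≠ 0 := fun h0 => by simpa [h0] using hle 0
  have key := genFun_one_eq (P := ((∏' i, G i : ℝ≥0) : ℝ≥0∞)) ha hrec ht ENNReal.coe_ne_top
    (by exact_mod_cast hP0) (fun k => by simp_rw [hGE]; exact_mod_cast hle k)
    (by simp_rw [hGE]; exact_mod_cast hlim)
  have hA' : genFun a t 0 = A₀ := by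
    rw [genFun_zero_right, ← hA.tsum_eq, ENNReal.coe_tsum hA.summable]
    push_cast
    rfl
  have h1 : genFun a t 1 =
      ∑' n, (((∑ r ∈ Finset.range (n + 1), a n r) * t ^ n : ℝ≥0) : ℝ≥0∞) := by
    refine tsum_congr fun n => ?_
    rw [tsum_eq_sum (s := Finset.range (n + 1)) fun r hr => by
      simp [ha n r (by rw [Finset.mem_range] at hr; omega)]]
    push_cast
    rw [Finset.sum_mul]
    simp
  rw [hA', h1, ← ENNReal.coe_mul] at key
  rw [← ENNReal.hasSum_coe, ← key]
  exact ENNReal.summable.hasSum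

end FunctionalEquation

section Euler

/-- `(p; p)_n = ∏_{k=1}^n (1 - pᵏ)`. -/
noncomputable def qFactor (p : ℝ) (n : ℕ) : ℝ := ∏ k ∈ Finset.range n, (1 - p ^ (k + 1))

theorem qFactor_pos {p : ℝ} (hp0 : 0 ≤ p) (hp : p < 1) (n : ℕ) : 0 < qFactor p n :=
  Finset.prod_pos fun k _ => sub_pos.2 (pow_lt_one₀ hp0 hp k.succ_ne_zero)

theorem qFactor_succ (p : ℝ) (n : ℕ) : qFactor p (n + 1) = qFactor p n * (1 - p ^ (n + 1)) :=
  Finset.prod_range_succ _ _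

theorem summable_inv_qFactor_mul_pow {p : ℝ} (hp0 : 0 ≤ p) (hp : p < 1) {x : ℝ} (hx0 : 0 ≤ x)
    (hx : x < 1) : Summable fun m => (qFactor p m)⁻¹ * x ^ m := by
  rcases hx0.eq_or_lt with rfl | hx0
  · exact summable_of_ne_finset_zero (s := {0}) fun m hm => by simp_all
  refine summable_of_ratio_test_tendsto_lt_one hx
    (Filter.Eventually.of_forall fun m =>
      mul_ne_zero (inv_ne_zero (qFactor_pos hp0 hp m).ne') (pow_ne_zero _ hx0.ne')) ?_
  have h : ∀ m, ‖(qFactor p (m + 1))⁻¹ * x ^ (m + 1)‖ / ‖(qFactor p m)⁻¹ * x ^ m‖ =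
      x / (1 - p ^ (m + 1)) := fun m => by
    have h1 := qFactor_pos hp0 hp m
    have h2 : 0 < 1 - p ^ (m + 1) := sub_pos.2 (pow_lt_one₀ hp0 hp m.succ_ne_zero)
    rw [Real.norm_of_nonneg (by rw [qFactor_succ]; positivity), Real.norm_of_nonneg (by positivity),
      qFactor_succ]
    field_simp
    ring
  simp_rw [h]
  have h3 := ((tendsto_pow_atTop_nhds_zero_of_lt_one hp0 hp).comp (Filter.tendsto_add_atTop_nat 1))
  have h4 := (tendsto_const_nhds (x := x)).div (h3.const_sub 1) (by norm_num)
  rw [sub_zero, div_one] at h4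
  exact h4

theorem tsum_inv_qFactor_mul {p : ℝ} (hp0 : 0 ≤ p) (hp : p < 1) {x : ℝ} (hx0 : 0 ≤ x)
    (hx : x < 1) : (∑' m, (qFactor p m)⁻¹ * x ^ m) * (1 - x) =
      ∑' m, (qFactor p m)⁻¹ * (p * x) ^ m := by
  have hs := summable_inv_qFactor_mul_pow hp0 hp hx0 hx
  have hs' := summable_inv_qFactor_mul_pow hp0 hp (mul_nonneg hp0 hx0)
    ((mul_le_of_le_one_left hx0 hp.le).trans_lt hx)
  have h1 : ∑' m, (qFactor p m)⁻¹ * x ^ m - ∑' m, (qFactor p m)⁻¹ * (p * x) ^ m =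
      x * ∑' m, (qFactor p m)⁻¹ * x ^ m := by
    rw [← hs.tsum_sub hs', (hs.sub hs').tsum_eq_zero_add, ← tsum_mul_left]
    simp only [pow_zero, sub_self, zero_add]
    refine tsum_congr fun m => ?_
    have h2 : 1 - p ^ (m + 1) ≠ 0 := (sub_pos.2 (pow_lt_one₀ hp0 hp m.succ_ne_zero)).ne'
    have h3 := (qFactor_pos hp0 hp m).ne'
    rw [qFactor_succ]
    field_simp
    ring
  linarith

/-- Euler's product expansion. -/
theorem hasProd_euler {p : ℝ} (hp0 : 0 ≤ p) (hp : p < 1) {x : ℝ} (hx0 : 0 ≤ x) (hx : x < 1) :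
    HasProd (fun j : ℕ => (1 - p ^ j * x)⁻¹) (∑' m, (qFactor p m)⁻¹ * x ^ m) := by
  have hpj : ∀ j : ℕ, p ^ j * x ≤ x := fun j => mul_le_of_le_one_left hx0 (pow_le_one₀ hp0 hp.le)
  have hnn : ∀ j : ℕ, 0 ≤ p ^ j * x := fun j => by positivity
  have hs := fun j : ℕ => summable_inv_qFactor_mul_pow hp0 hp (hnn j) ((hpj j).trans_lt hx)
  have hs0 := summable_inv_qFactor_mul_pow hp0 hp hx0 hx
  set S := ∑' m, (qFactor p m)⁻¹ * x ^ m with hS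
  have hterm : ∀ m (y : ℝ), 0 ≤ y → 0 ≤ (qFactor p m)⁻¹ * y ^ m := fun m y hy =>
    mul_nonneg (inv_nonneg.2 (qFactor_pos hp0 hp m).le) (pow_nonneg hy m)
  have hge : ∀ k : ℕ, 1 ≤ ∑' m, (qFactor p m)⁻¹ * (p ^ k * x) ^ m := fun k => by
    simpa [qFactor] using (hs k).le_tsum 0 fun m _ => hterm m _ (hnn k)
  have hle : ∀ k : ℕ, ∑' m, (qFactor p m)⁻¹ * (p ^ k * x) ^ m ≤ 1 + p ^ k * S := fun k => by
    rw [(hs k).tsum_eq_zero_add, hS, hs0.tsum_eq_zero_add, mul_add, ← tsum_mul_left]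
    have h1 : ∑' m, (qFactor p (m + 1))⁻¹ * (p ^ k * x) ^ (m + 1) ≤
        ∑' m, p ^ k * ((qFactor p (m + 1))⁻¹ * x ^ (m + 1)) := by
      refine Summable.tsum_le_tsum (fun m => ?_) ((summable_nat_add_iff 1).2 (hs k))
        (((summable_nat_add_iff 1).2 hs0).mul_left _)
      have h2 : (p ^ k) ^ (m + 1) ≤ p ^ k :=
        pow_le_of_le_one (by positivity) (pow_le_one₀ hp0 hp.le) m.succ_ne_zero
      have h3 := hterm (m + 1) x hx0
      calc _ = (p ^ k) ^ (m + 1) * ((qFactor p (m + 1))⁻¹ * x ^ (m + 1)) := by ring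
        _ ≤ _ := by gcongr
    have h4 : 0 ≤ p ^ k := by positivity
    simp only [qFactor, Finset.range_zero, Finset.prod_empty, pow_zero] at h1 ⊢
    linarith
  have hlim : Filter.Tendsto (fun k : ℕ => ∑' m, (qFactor p m)⁻¹ * (p ^ k * x) ^ m)
      Filter.atTop (nhds 1) := by
    refine tendsto_of_tendsto_of_tendsto_of_le_of_le tendsto_const_nhds ?_ hge hle
    simpa using ((tendsto_pow_atTop_nhds_zero_of_lt_one hp0 hp).mul_const S).const_add 1
  have hprod : ∀ k : ℕ, ∏ j ∈ Finset.range k, (1 - p ^ j * x)⁻¹ =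
      S / ∑' m, (qFactor p m)⁻¹ * (p ^ k * x) ^ m := fun k => by
    induction k with
    | zero =>
      have : S ≠ 0 := by have := hge 0; simp only [pow_zero, one_mul] at this; linarith
      simp [← hS, this]
    | succ k ih =>
      have h1 := tsum_inv_qFactor_mul hp0 hp (hnn k) ((hpj k).trans_lt hx)
      have h2 : 0 < 1 - p ^ k * x := sub_pos.2 ((hpj k).trans_lt hx)
      have h3 := hge k
      rw [Finset.prod_range_succ, ih, pow_succ', mul_assoc p, ← h1]
      field_simp
  have hmul : Multipliable (fun j : ℕ => (1 - p ^ j * x)⁻¹) := by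
    have hsum : Summable fun j : ℕ => p ^ j * x * (1 - p ^ j * x)⁻¹ := by
      refine Summable.of_nonneg_of_le (fun j => mul_nonneg (hnn j)
        (inv_nonneg.2 (sub_nonneg.2 ((hpj j).trans hx.le)))) (fun j => ?_)
        ((summable_geometric_of_lt_one hp0 hp).mul_right (x * (1 - x)⁻¹))
      rw [mul_assoc]
      have := hpj j
      have : 0 < 1 - x := sub_pos.2 hx
      gcongr
    convert Real.multipliable_one_add_of_summable hsum using 2 with j
    have h2 : 0 < 1 - p ^ j * x := sub_pos.2 ((hpj j).trans_lt hx)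
    field_simp
    ring
  have hl2 := hmul.hasProd.tendsto_prod_nat
  simp_rw [hprod] at hl2
  have hl3 := (tendsto_const_nhds (x := S)).div hlim one_ne_zero
  rw [div_one] at hl3
  rw [← tendsto_nhds_unique hl2 hl3]
  exact hmul.hasProd

end Euler

section Cancellation

universe v w

/-- A linear map is an injective map out of a quotient of its source. -/
noncomputable def linearMapEquivSigmaInjective (R : Type v) [Ring R] (X M : Type w)
    [AddCommGroup X] [Module R X] [AddCommGroup M] [Module R M] :
    (X →ₗ[R] M) ≃ Σ N : Submodule R X, {g : (X ⧸ N) →ₗ[R] M // Function.Injective g} where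
  toFun f := ⟨LinearMap.ker f, (LinearMap.ker f).liftQ f le_rfl,
    LinearMap.ker_eq_bot.1 (Submodule.ker_liftQ_eq_bot _ _ _ le_rfl)⟩
  invFun p := p.2.1 ∘ₗ p.1.mkQ
  left_inv f := Submodule.liftQ_mkQ _ _ _
  right_inv := by
    rintro ⟨N, g, hg⟩
    have hN : LinearMap.ker (g ∘ₗ N.mkQ) = N := by
      rw [LinearMap.ker_comp, LinearMap.ker_eq_bot.2 hg, Submodule.comap_bot, Submodule.ker_mkQ]
    refine Sigma.ext hN ?_
    have key : ∀ (K : Submodule R X) (hK : K = N) (f : X →ₗ[R] M) (hf : f = g ∘ₗ N.mkQ)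
        (hle : K ≤ LinearMap.ker f) (hinj : Function.Injective (K.liftQ f hle)),
        HEq (⟨K.liftQ f hle, hinj⟩ : {g : (X ⧸ K) →ₗ[R] M // Function.Injective g})
          (⟨g, hg⟩ : {g : (X ⧸ N) →ₗ[R] M // Function.Injective g}) := by
      rintro K rfl f rfl hle hinj
      refine heq_of_eq (Subtype.ext ?_)
      ext x
      simp
    exact key _ hN _ rfl _ _

variable {R : Type v} [Ring R]

instance finite_linearMap (X M : Type w) [AddCommGroup X] [Module R X] [AddCommGroup M]
    [Module R M] [Finite X] [Finite M] : Finite (X →ₗ[R] M) :=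
  Finite.of_injective (fun f : X →ₗ[R] M => (f : X → M)) DFunLike.coe_injective

/-- The numbers of injective maps between finite modules are determined by the numbers of all
maps. -/
theorem card_injective_eq_of_card_linearMap_eq {M N : Type w} [AddCommGroup M] [Module R M]
    [AddCommGroup N] [Module R N] [Finite M] [Finite N]
    (h : ∀ (X : Type w) [AddCommGroup X] [Module R X] [Finite X],
      Nat.card (X →ₗ[R] M) = Nat.card (X →ₗ[R] N)) (k : ℕ) :
    ∀ (X : Type w) [AddCommGroup X] [Module R X] [Finite X], Nat.card X = k →
      Nat.card {g : X →ₗ[R] M // Function.Injective g} =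
        Nat.card {g : X →ₗ[R] N // Function.Injective g} := by
  classical
  induction k using Nat.strong_induction_on with
  | _ k ih =>
    intro X _ _ _ hX
    have : Fintype (Submodule R X) := Fintype.ofFinite _
    have hfin : ∀ K : Submodule R X, Finite (X ⧸ K) := fun K =>
      Finite.of_surjective _ K.mkQ_surjective
    have hXM := h X
    rw [Nat.card_congr (linearMapEquivSigmaInjective R X M),
      Nat.card_congr (linearMapEquivSigmaInjective R X N), Nat.card_sigma, Nat.card_sigma,
      ← Finset.add_sum_erase _ _ (Finset.mem_univ ⊥),
      ← Finset.add_sum_erase _ _ (Finset.mem_univ ⊥)] at hXM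
    have hrest : ∀ K ∈ Finset.univ.erase (⊥ : Submodule R X),
        Nat.card {g : (X ⧸ K) →ₗ[R] M // Function.Injective g} =
          Nat.card {g : (X ⧸ K) →ₗ[R] N // Function.Injective g} := fun K hK => by
      refine ih _ ?_ (X ⧸ K) rfl
      rw [← hX, Submodule.card_eq_card_quotient_mul_card K]
      have h1 : 1 < Nat.card K := by
        have : Nontrivial K := (Submodule.nontrivial_iff_ne_bot).2 (Finset.ne_of_mem_erase hK)
        exact Finite.one_lt_card
      have h2 : 0 < Nat.card (X ⧸ K) := Nat.card_pos
      nlinarith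
    rw [Finset.sum_congr rfl hrest] at hXM
    have hbot : ∀ (L : Type w) [AddCommGroup L] [Module R L],
        Nat.card {g : (X ⧸ (⊥ : Submodule R X)) →ₗ[R] L // Function.Injective g} =
          Nat.card {g : X →ₗ[R] L // Function.Injective g} := fun L _ _ =>
      Nat.card_congr <| (LinearEquiv.congrLeft L ℕ
        (Submodule.quotEquivOfEqBot (⊥ : Submodule R X) rfl)).toEquiv.subtypeEquiv fun g => by
          exact ((Submodule.quotEquivOfEqBot (⊥ : Submodule R X) rfl).symm.toEquiv.injective_comp
            g).symm
    rw [← hbot M, ← hbot N]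
    exact Nat.add_right_cancel hXM

theorem nonempty_linearEquiv_of_card_linearMap_eq {M N : Type w} [AddCommGroup M] [Module R M]
    [AddCommGroup N] [Module R N] [Finite M] [Finite N]
    (h : ∀ (X : Type w) [AddCommGroup X] [Module R X] [Finite X],
      Nat.card (X →ₗ[R] M) = Nat.card (X →ₗ[R] N)) : Nonempty (M ≃ₗ[R] N) := by
  have hM := card_injective_eq_of_card_linearMap_eq h _ M rfl
  have hN := card_injective_eq_of_card_linearMap_eq h _ N rfl
  have : Nonempty {g : M →ₗ[R] M // Function.Injective g} := ⟨LinearMap.id, fun _ _ => id⟩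
  have : Nonempty {g : N →ₗ[R] N // Function.Injective g} := ⟨LinearMap.id, fun _ _ => id⟩
  obtain ⟨⟨f, hf⟩⟩ := (Nat.card_pos_iff.1 (hM ▸ Nat.card_pos)).1
  obtain ⟨⟨g, hg⟩⟩ := (Nat.card_pos_iff.1 (hN.symm ▸ Nat.card_pos)).1
  have hcard := le_antisymm (Nat.card_le_card_of_injective f hf)
    (Nat.card_le_card_of_injective g hg)
  exact ⟨LinearEquiv.ofBijective f ((Nat.bijective_iff_injective_and_card f).2 ⟨hf, hcard⟩)⟩

/-- Finite modules can be cancelled from direct sums. -/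
theorem nonempty_linearEquiv_of_prod {Q M N : Type w} [AddCommGroup Q] [Module R Q]
    [AddCommGroup M] [Module R M] [AddCommGroup N] [Module R N] [Finite Q] [Finite M] [Finite N]
    (e : (Q × M) ≃ₗ[R] (Q × N)) : Nonempty (M ≃ₗ[R] N) := by
  refine nonempty_linearEquiv_of_card_linearMap_eq fun X _ _ _ => ?_
  have hprod : ∀ (L : Type w) [AddCommGroup L] [Module R L],
      Nat.card (X →ₗ[R] Q × L) = Nat.card (X →ₗ[R] Q) * Nat.card (X →ₗ[R] L) := fun L _ _ => by
    rw [← Nat.card_prod]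
    exact Nat.card_congr (LinearMap.prodEquiv ℕ).toEquiv.symm
  have h : Nat.card (X →ₗ[R] Q × M) = Nat.card (X →ₗ[R] Q × N) :=
    Nat.card_congr ((LinearEquiv.refl R X).arrowCongrAddEquiv e).toEquiv
  rw [hprod, hprod] at h
  exact Nat.eq_of_mul_eq_mul_left Nat.card_pos h

end Cancellation

section Counting

theorem card_subtype_prod_eq_mul {α β : Type*} [Finite α] [Finite β] {p : α → Prop}
    {r : α → β → Prop} {c : ℕ} (h : ∀ a, p a → Nat.card {b // r a b} = c) :
    Nat.card {x : α × β // p x.1 ∧ r x.1 x.2} = Nat.card {a // p a} * c := by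
  classical
  have : Fintype {a // p a} := Fintype.ofFinite _
  let e : {x : α × β // p x.1 ∧ r x.1 x.2} ≃ Σ a : {a // p a}, {b // r a.1 b} :=
    { toFun := fun x => ⟨⟨x.1.1, x.2.1⟩, ⟨x.1.2, x.2.2⟩⟩
      invFun := fun y => ⟨(y.1.1, y.2.1), y.1.2, y.2.2⟩
      left_inv := fun _ => rfl
      right_inv := fun _ => rfl }
  rw [Nat.card_congr e, Nat.card_sigma, Finset.sum_congr rfl fun a _ => h a.1 a.2]
  simp

theorem card_subtype_eq_sum {α : Type*} [Finite α] {p : α → Prop} (g : α → ℕ) {m : ℕ}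
    (h : ∀ x, p x → g x < m) :
    Nat.card {x // p x} = ∑ s ∈ Finset.range m, Nat.card {x // p x ∧ g x = s} := by
  classical
  let e : {x // p x} ≃ Σ s : Fin m, {x // p x ∧ g x = s} :=
    { toFun := fun x => ⟨⟨g x.1, h x.1 x.2⟩, ⟨x.1, x.2, rfl⟩⟩
      invFun := fun y => ⟨y.2.1, y.2.2.1⟩
      left_inv := fun _ => rfl
      right_inv := by
        rintro ⟨⟨s, hs⟩, x, hx, hxs⟩
        obtain rfl : g x = s := hxs
        rfl }
  rw [Nat.card_congr e, Nat.card_sigma, Finset.sum_range]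

variable {F : Type*} [Field F]

theorem card_fiber_of_surjective {M N : Type*} [AddCommGroup M] [Module F M]
    [AddCommGroup N] [Module F N] [FiniteDimensional F M] [FiniteDimensional F N]
    {f : M →ₗ[F] N} (hf : Function.Surjective f) (y : N) :
    Nat.card {x // f x = y} = Nat.card F ^ (Module.finrank F M - Module.finrank F N) := by
  obtain ⟨x₀, rfl⟩ := hf y
  have e : {x // f x = f x₀} ≃ LinearMap.ker f :=
    (Equiv.subRight x₀).subtypeEquiv fun x => by simp [sub_eq_zero]
  rw [Nat.card_congr e, Module.natCard_eq_pow_finrank (K := F)]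
  have := f.finrank_range_add_finrank_ker
  rw [LinearMap.range_eq_top.2 hf, finrank_top] at this
  congr 1
  omega

variable {K U V : Type*} [AddCommGroup K] [Module F K] [AddCommGroup U] [Module F U]
  [AddCommGroup V] [Module F V]

theorem card_extensions [Finite F] [FiniteDimensional F U] [FiniteDimensional F K]
    [FiniteDimensional F V] {j : U →ₗ[F] V} (hj : Function.Injective j) (T : U →ₗ[F] K) :
    Nat.card {Y : V →ₗ[F] K // Y ∘ₗ j = T} = Nat.card F ^
      (Module.finrank F V * Module.finrank F K - Module.finrank F U * Module.finrank F K) := by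
  obtain ⟨l, hl⟩ := j.exists_leftInverse_of_injective (LinearMap.ker_eq_bot.2 hj)
  have hsurj : Function.Surjective (LinearMap.lcomp F K j) := fun T =>
    ⟨T ∘ₗ l, by ext x; simpa using congrArg T (LinearMap.congr_fun hl x)⟩
  have := card_fiber_of_surjective hsurj T
  rw [Module.finrank_linearMap, Module.finrank_linearMap] at this
  exact this

theorem card_injective_linearMap [Finite F] [FiniteDimensional F U] [FiniteDimensional F K]
    {s r : ℕ} (hU : Module.finrank F U = s)
    (hK : Module.finrank F K = r) (hsr : s ≤ r) :
    Nat.card {T : U →ₗ[F] K // Function.Injective T} =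
      ∏ i ∈ Finset.range s, (Nat.card F ^ r - Nat.card F ^ i) := by
  have : Fintype F := Fintype.ofFinite F
  have : Finite K := Module.finite_of_finite F
  let b := Module.finBasisOfFinrankEq F U hU
  have e : {v : Fin s → K // LinearIndependent F v} ≃
      {T : U →ₗ[F] K // Function.Injective T} :=
    (b.constr ℕ).toEquiv.subtypeEquiv fun v => by
      have h : ⇑(b.constr ℕ v) = Finsupp.linearCombination F v ∘ b.repr := by
        ext x
        simp [Module.Basis.constr_def]
      change _ ↔ Function.Injective (b.constr ℕ v)
      rw [h]
      exact (b.repr.toEquiv.injective_comp _).symm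
  rw [← Nat.card_congr e, card_linearIndependent (by omega), hK, Nat.card_eq_fintype_card,
    Finset.prod_range]

theorem injective_prod_iff (C : U →ₗ[F] V) (Z : U →ₗ[F] K) :
    Function.Injective (Z.prod C) ↔ Function.Injective (Z ∘ₗ (LinearMap.ker C).subtype) := by
  rw [← LinearMap.ker_eq_bot, ← LinearMap.ker_eq_bot, LinearMap.ker_prod, LinearMap.ker_comp,
    Submodule.eq_bot_iff, Submodule.eq_bot_iff]
  constructor
  · rintro h ⟨x, hx⟩ hx'
    exact Subtype.ext (h x ⟨hx', hx⟩)
  · rintro h x ⟨hx', hx⟩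
    exact congrArg Subtype.val (h ⟨x, hx⟩ hx')

theorem card_injective_prod [Finite F] [FiniteDimensional F U] [FiniteDimensional F K]
    {s r : ℕ} (C : U →ₗ[F] V)
    (hC : Module.finrank F (LinearMap.ker C) = s)
    (hK : Module.finrank F K = r) (hsr : s ≤ r) :
    Nat.card {Z : U →ₗ[F] K // Function.Injective (Z.prod C)} =
      (∏ i ∈ Finset.range s, (Nat.card F ^ r - Nat.card F ^ i)) *
        Nat.card F ^ (Module.finrank F U * r - s * r) := by
  have : Finite K := Module.finite_of_finite F
  have : Finite U := Module.finite_of_finite F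
  have : Finite (U →ₗ[F] K) := DFunLike.finite _
  have : Finite (LinearMap.ker C →ₗ[F] K) := DFunLike.finite _
  have e : {Z : U →ₗ[F] K // Function.Injective (Z.prod C)} ≃
      {x : (LinearMap.ker C →ₗ[F] K) × (U →ₗ[F] K) //
        Function.Injective x.1 ∧ x.2 ∘ₗ (LinearMap.ker C).subtype = x.1} :=
    { toFun := fun Z => ⟨(Z.1 ∘ₗ (LinearMap.ker C).subtype, Z.1),
        (injective_prod_iff C Z.1).1 Z.2, rfl⟩
      invFun := fun x => ⟨x.1.2, (injective_prod_iff C x.1.2).2 (x.2.2 ▸ x.2.1)⟩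
      left_inv := fun _ => rfl
      right_inv := fun x => Subtype.ext (Prod.ext x.2.2 rfl) }
  rw [Nat.card_congr e, card_subtype_prod_eq_mul
    (p := fun T : LinearMap.ker C →ₗ[F] K => Function.Injective T)
    (r := fun T (Z : U →ₗ[F] K) => Z ∘ₗ (LinearMap.ker C).subtype = T)
    (fun T _ => card_extensions (LinearMap.ker C).injective_subtype T),
    card_injective_linearMap hC hK hsr, hC, hK]

variable (F V) in
/-- The number of commuting pairs of endomorphisms of `V`, the second of corank `r`. -/
noncomputable def numPairs (r : ℕ) : ℕ :=
  Nat.card {p : Module.End F V × Module.End F V //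
    p.1 * p.2 = p.2 * p.1 ∧ Module.finrank F (LinearMap.ker p.2) = r}

/-- Simultaneous conjugation of a pair of endomorphisms. -/
def pairConj (e : U ≃ₗ[F] V) :
    Module.End F U × Module.End F U ≃ Module.End F V × Module.End F V :=
  Equiv.prodCongr e.conj.toEquiv e.conj.toEquiv

theorem pairConj_comm_iff (e : U ≃ₗ[F] V) (p : Module.End F U × Module.End F U) :
    (pairConj e p).1 * (pairConj e p).2 = (pairConj e p).2 * (pairConj e p).1 ↔
      p.1 * p.2 = p.2 * p.1 := by
  change e.conj p.1 * e.conj p.2 = e.conj p.2 * e.conj p.1 ↔ _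
  rw [Module.End.mul_eq_comp, Module.End.mul_eq_comp, ← e.conj_comp, ← e.conj_comp,
    e.conj.injective.eq_iff]
  rfl

theorem ker_pairConj (e : U ≃ₗ[F] V) (p : Module.End F U × Module.End F U) :
    LinearMap.ker (pairConj e p).2 = (LinearMap.ker p.2).map (e : U →ₗ[F] V) := by
  ext x
  change e.conj p.2 x = 0 ↔ _
  rw [Submodule.mem_map_equiv, LinearMap.mem_ker, LinearEquiv.conj_apply_apply]
  simp

theorem numPairs_congr (e : U ≃ₗ[F] V) (r : ℕ) : numPairs F U r = numPairs F V r :=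
  Nat.card_congr <| (pairConj e).subtypeEquiv fun p => by
    rw [pairConj_comm_iff, ker_pairConj, LinearEquiv.finrank_map_eq]

variable (F K U) in
/-- Commuting pairs of endomorphisms of `K × U`, the second with kernel `K × 0`. -/
abbrev PairsKerFst : Type _ :=
  {p : Module.End F (K × U) × Module.End F (K × U) //
    p.1 * p.2 = p.2 * p.1 ∧ LinearMap.ker p.2 = LinearMap.range (LinearMap.inl F K U)}

variable (F K U) in
/-- The block decomposition of a commuting pair in `PairsKerFst`. -/
abbrev PairsBlocks : Type _ :=
  {x : ((Module.End F U × Module.End F U) × (U →ₗ[F] K)) × (K × U →ₗ[F] K) //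
    (x.1.1.1 * x.1.1.2 = x.1.1.2 * x.1.1.1 ∧ Function.Injective (x.1.2.prod x.1.1.2)) ∧
      x.2 ∘ₗ x.1.2.prod x.1.1.2 = x.1.2 ∘ₗ x.1.1.1}

theorem blocks_comm_iff (B C : Module.End F U) (Z : U →ₗ[F] K) (Y : K × U →ₗ[F] K) :
    ((Y.prod (B ∘ₗ LinearMap.snd F K U) : Module.End F (K × U)) *
        ((Z.prod C) ∘ₗ LinearMap.snd F K U) =
      ((Z.prod C) ∘ₗ LinearMap.snd F K U) * (Y.prod (B ∘ₗ LinearMap.snd F K U)) ) ↔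
    B * C = C * B ∧ Y ∘ₗ Z.prod C = Z ∘ₗ B := by
  constructor
  · intro h
    constructor
    · ext u
      exact congrArg Prod.snd (LinearMap.congr_fun h (0, u))
    · ext u
      exact congrArg Prod.fst (LinearMap.congr_fun h (0, u))
  · rintro ⟨h₁, h₂⟩
    refine LinearMap.ext fun x => Prod.ext ?_ ?_
    · exact LinearMap.congr_fun h₂ x.2
    · exact LinearMap.congr_fun h₁ x.2

theorem ker_comp_snd_eq_iff (T : U →ₗ[F] K × U) :
    LinearMap.ker (T ∘ₗ LinearMap.snd F K U) = LinearMap.range (LinearMap.inl F K U) ↔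
      Function.Injective T := by
  rw [← LinearMap.ker_eq_bot, LinearMap.range_inl, LinearMap.ker_comp]
  constructor
  · intro h
    rw [Submodule.eq_bot_iff]
    intro u hu
    have : ((0 : K), u) ∈ Submodule.comap (LinearMap.snd F K U) (LinearMap.ker T) := hu
    rw [h] at this
    exact this
  · intro h
    rw [h]
    rfl

theorem card_pairsKerFst : Nat.card (PairsKerFst F K U) = Nat.card (PairsBlocks F K U) := by
  symm
  refine Nat.card_congr (Equiv.ofBijective (fun x => ⟨(x.1.2.prod (x.1.1.1.1 ∘ₗ LinearMap.snd F K U),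
    (x.1.1.2.prod x.1.1.1.2) ∘ₗ LinearMap.snd F K U),
      (blocks_comm_iff _ _ _ _).2 ⟨x.2.1.1, x.2.2⟩, (ker_comp_snd_eq_iff _).2 x.2.1.2⟩) ⟨?_, ?_⟩)
  · rintro ⟨⟨⟨⟨B, C⟩, Z⟩, Y⟩, h⟩ ⟨⟨⟨⟨B', C'⟩, Z'⟩, Y'⟩, h'⟩ heq
    have hB := congrArg Prod.fst (congrArg Subtype.val heq)
    have hC := congrArg Prod.snd (congrArg Subtype.val heq)
    dsimp only at hB hC
    have h1 : B = B' := LinearMap.ext fun u => congrArg Prod.snd (LinearMap.congr_fun hB (0, u))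
    have h2 : C = C' := LinearMap.ext fun u => congrArg Prod.snd (LinearMap.congr_fun hC (0, u))
    have h3 : Z = Z' := LinearMap.ext fun u => congrArg Prod.fst (LinearMap.congr_fun hC (0, u))
    have h4 : Y = Y' := LinearMap.ext fun u => congrArg Prod.fst (LinearMap.congr_fun hB u)
    subst h1 h2 h3 h4
    rfl
  · rintro ⟨⟨B, C⟩, hcomm, hker⟩
    dsimp only at hcomm hker
    have hC0 : ∀ k, C (k, 0) = 0 := fun k => by
      rw [← LinearMap.mem_ker, hker]
      exact ⟨k, rfl⟩
    have hB0 : ∀ k, (B (k, 0)).2 = 0 := fun k => by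
      have h : B (k, 0) ∈ LinearMap.ker C := by
        rw [LinearMap.mem_ker]
        change (C * B) (k, 0) = 0
        rw [← hcomm]
        change B (C (k, 0)) = 0
        rw [hC0, map_zero]
      rw [hker] at h
      obtain ⟨k', hk'⟩ := h
      rw [← hk']
      rfl
    have hsplit : ∀ x : K × U, x = (x.1, 0) + (0, x.2) := fun x => by simp
    have hC : C = ((LinearMap.fst F K U ∘ₗ C ∘ₗ LinearMap.inr F K U).prod
        (LinearMap.snd F K U ∘ₗ C ∘ₗ LinearMap.inr F K U)) ∘ₗ LinearMap.snd F K U := by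
      refine LinearMap.ext fun x => ?_
      conv_lhs => rw [hsplit x, map_add, hC0, zero_add]
      rfl
    have hB : B = (LinearMap.fst F K U ∘ₗ B).prod
        ((LinearMap.snd F K U ∘ₗ B ∘ₗ LinearMap.inr F K U) ∘ₗ LinearMap.snd F K U) := by
      refine LinearMap.ext fun x => Prod.ext rfl ?_
      conv_lhs => rw [hsplit x, map_add, Prod.snd_add, hB0, zero_add]
      rfl
    have h1 := (blocks_comm_iff _ _ _ _).1 (by rw [← hC, ← hB]; exact hcomm)
    have h2 := (ker_comp_snd_eq_iff _).1 (by rw [← hC]; exact hker)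
    refine ⟨⟨(((LinearMap.snd F K U ∘ₗ B ∘ₗ LinearMap.inr F K U,
      LinearMap.snd F K U ∘ₗ C ∘ₗ LinearMap.inr F K U),
      LinearMap.fst F K U ∘ₗ C ∘ₗ LinearMap.inr F K U), LinearMap.fst F K U ∘ₗ B),
      ⟨h1.1, h2⟩, h1.2⟩, Subtype.ext (Prod.ext hB.symm hC.symm)⟩

theorem card_pairsBlocks [Finite F] [FiniteDimensional F U] [FiniteDimensional F K] {n r : ℕ}
    (hU : Module.finrank F U = n) (hK : Module.finrank F K = r) :
    Nat.card (PairsBlocks F K U) =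
      (∑ s ∈ Finset.range (r + 1), numPairs F U s *
        ((∏ i ∈ Finset.range s, (Nat.card F ^ r - Nat.card F ^ i)) *
          Nat.card F ^ (n * r - s * r))) *
        Nat.card F ^ ((n + r) * r - n * r) := by
  have : Finite K := Module.finite_of_finite F
  have : Finite U := Module.finite_of_finite F
  have : Finite (U →ₗ[F] K) := DFunLike.finite _
  have : Finite (K × U →ₗ[F] K) := DFunLike.finite _
  have : Finite (Module.End F U) := DFunLike.finite _
  unfold PairsBlocks
  rw [card_subtype_prod_eq_mul
    (p := fun x : (Module.End F U × Module.End F U) × (U →ₗ[F] K) =>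
      x.1.1 * x.1.2 = x.1.2 * x.1.1 ∧ Function.Injective (x.2.prod x.1.2))
    (r := fun x (Y : K × U →ₗ[F] K) => Y ∘ₗ x.2.prod x.1.2 = x.2 ∘ₗ x.1.1)
    (fun x hx => card_extensions hx.2 _)]
  rw [Module.finrank_prod, hU, hK, add_comm r n,
    card_subtype_eq_sum (fun x => Module.finrank F (LinearMap.ker x.1.2)) (m := r + 1)]
  · congr 1
    refine Finset.sum_congr rfl fun s hs => ?_
    have hZ : ∀ x : Module.End F U × Module.End F U,
        (x.1 * x.2 = x.2 * x.1 ∧ Module.finrank F (LinearMap.ker x.2) = s) →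
        Nat.card {Z : U →ₗ[F] K // Function.Injective (Z.prod x.2)} =
          (∏ i ∈ Finset.range s, (Nat.card F ^ r - Nat.card F ^ i)) *
            Nat.card F ^ (n * r - s * r) := by
      rintro x ⟨-, hx⟩
      rw [card_injective_prod x.2 hx hK (by simpa [Nat.lt_succ_iff] using hs), hU]
    have := card_subtype_prod_eq_mul
      (p := fun x : Module.End F U × Module.End F U =>
        x.1 * x.2 = x.2 * x.1 ∧ Module.finrank F (LinearMap.ker x.2) = s)
      (r := fun x (Z : U →ₗ[F] K) => Function.Injective (Z.prod x.2)) hZ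
    rw [numPairs, ← this]
    refine Nat.card_congr (Equiv.subtypeEquivRight fun x => ?_)
    exact and_right_comm
  · rintro x ⟨-, hx⟩
    rw [injective_prod_iff] at hx
    have := LinearMap.finrank_le_finrank_of_injective hx
    omega

/-- The number of commuting pairs of endomorphisms with the second having a prescribed kernel. -/
theorem card_pairs_ker_eq [Finite F] [FiniteDimensional F V] {n r : ℕ}
    (hV : Module.finrank F V = n + r) (W : Submodule F V) (hW : Module.finrank F W = r) :
    Nat.card {p : Module.End F V × Module.End F V //
        p.1 * p.2 = p.2 * p.1 ∧ LinearMap.ker p.2 = W} =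
      (∑ s ∈ Finset.range (r + 1), numPairs F (Fin n → F) s *
        ((∏ i ∈ Finset.range s, (Nat.card F ^ r - Nat.card F ^ i)) *
          Nat.card F ^ (n * r - s * r))) *
        Nat.card F ^ ((n + r) * r - n * r) := by
  obtain ⟨U, hWU⟩ := W.exists_isCompl
  have hU : Module.finrank F U = n := by
    have := Submodule.finrank_add_eq_of_isCompl hWU
    omega
  have hmap : (LinearMap.range (LinearMap.inl F W U)).map
      (W.prodEquivOfIsCompl U hWU : (W × U) →ₗ[F] V) = W := by
    ext x
    simp
  simp_rw [← numPairs_congr (Module.finBasisOfFinrankEq F U hU).equivFun]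
  rw [← card_pairsBlocks hU hW, ← card_pairsKerFst]
  refine (Nat.card_congr ((pairConj (W.prodEquivOfIsCompl U hWU)).subtypeEquiv fun p => ?_)).symm
  rw [pairConj_comm_iff, ker_pairConj]
  refine and_congr Iff.rfl ⟨fun h => by rw [h, hmap], fun h => ?_⟩
  exact Submodule.map_injective_of_injective (W.prodEquivOfIsCompl U hWU).injective
    (h.trans hmap.symm)

theorem card_bases_of_submodule [Finite F] [FiniteDimensional F V] {r : ℕ} (W : Submodule F V)
    (hW : Module.finrank F W = r) :
    Nat.card {b : Fin r → V // LinearIndependent F b ∧ Submodule.span F (Set.range b) = W} =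
      ∏ i ∈ Finset.range r, (Nat.card F ^ r - Nat.card F ^ i) := by
  have : Fintype F := Fintype.ofFinite F
  have : Finite V := Module.finite_of_finite F
  have h := card_linearIndependent (K := F) (V := W) (k := r) hW.ge
  rw [hW, ← Nat.card_eq_fintype_card] at h
  rw [Finset.prod_range, ← h]
  refine Nat.card_congr
    { toFun := fun b => ⟨fun i => ⟨b.1 i, b.2.2.le (Submodule.subset_span ⟨i, rfl⟩)⟩,
        LinearIndependent.of_comp W.subtype b.2.1⟩
      invFun := fun b => ⟨fun i => (b.1 i : V), b.2.map' W.subtype W.ker_subtype, ?_⟩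
      left_inv := fun _ => rfl
      right_inv := fun _ => rfl }
  have hb := b.2.span_eq_top_of_card_eq_finrank' (by simp [hW])
  have := congrArg (Submodule.map W.subtype) hb
  rwa [Submodule.map_span, Submodule.map_top, Submodule.range_subtype, ← Set.range_comp] at this

theorem numPairs_mul_prod [Finite F] [FiniteDimensional F V] {n r : ℕ}
    (hV : Module.finrank F V = n + r) :
    numPairs F V r * ∏ i ∈ Finset.range r, (Nat.card F ^ r - Nat.card F ^ i) =
      (∏ i ∈ Finset.range r, (Nat.card F ^ (n + r) - Nat.card F ^ i)) *
      ((∑ s ∈ Finset.range (r + 1), numPairs F (Fin n → F) s *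
        ((∏ i ∈ Finset.range s, (Nat.card F ^ r - Nat.card F ^ i)) *
          Nat.card F ^ (n * r - s * r))) *
        Nat.card F ^ ((n + r) * r - n * r)) := by
  have : Fintype F := Fintype.ofFinite F
  have : Finite V := Module.finite_of_finite F
  have : Finite (Module.End F V) := DFunLike.finite _
  have h₁ := card_subtype_prod_eq_mul
    (p := fun p : Module.End F V × Module.End F V =>
      p.1 * p.2 = p.2 * p.1 ∧ Module.finrank F (LinearMap.ker p.2) = r)
    (r := fun p (b : Fin r → V) =>
      LinearIndependent F b ∧ Submodule.span F (Set.range b) = LinearMap.ker p.2)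
    (fun p hp => card_bases_of_submodule (LinearMap.ker p.2) hp.2)
  have h₂ := card_subtype_prod_eq_mul
    (p := fun b : Fin r → V => LinearIndependent F b)
    (r := fun b (p : Module.End F V × Module.End F V) =>
      p.1 * p.2 = p.2 * p.1 ∧ LinearMap.ker p.2 = Submodule.span F (Set.range b))
    (fun b hb => card_pairs_ker_eq hV _ ((finrank_span_eq_card hb).trans (by simp)))
  have h₃ := card_linearIndependent (K := F) (V := V) (k := r) (by omega)
  rw [hV, ← Nat.card_eq_fintype_card] at h₃
  rw [h₃, ← Finset.prod_range (fun i => Nat.card F ^ (n + r) - Nat.card F ^ i)] at h₂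
  rw [numPairs, ← h₁, ← h₂]
  refine Nat.card_congr ((Equiv.prodComm _ _).subtypeEquiv fun x => ?_)
  change _ ↔ LinearIndependent F x.2 ∧ x.1.1 * x.1.2 = x.1.2 * x.1.1 ∧
    LinearMap.ker x.1.2 = Submodule.span F (Set.range x.2)
  constructor
  · rintro ⟨⟨h, -⟩, hb, hs⟩
    exact ⟨hb, h, hs.symm⟩
  · rintro ⟨hb, h, hs⟩
    exact ⟨⟨h, by rw [hs, finrank_span_eq_card hb, Fintype.card_fin]⟩, hb, hs.symm⟩

theorem numPairs_eq_zero [FiniteDimensional F V] {n r : ℕ} (hV : Module.finrank F V = n)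
    (h : n < r) : numPairs F V r = 0 := by
  have : IsEmpty {p : Module.End F V × Module.End F V //
      p.1 * p.2 = p.2 * p.1 ∧ Module.finrank F (LinearMap.ker p.2) = r} :=
    ⟨fun p => by
      have := Submodule.finrank_le (LinearMap.ker p.1.2)
      rw [p.2.2] at this
      omega⟩
  exact Nat.card_of_isEmpty

end Counting

theorem ccount_eq_sum_numPairs (F : Type*) [Field F] [Fintype F] (n : ℕ) :
    ccount F n = ∑ r ∈ Finset.range (n + 1), numPairs F (Fin n → F) r := by
  have : Finite (Module.End F (Fin n → F)) := DFunLike.finite _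
  unfold numPairs
  rw [← card_subtype_eq_sum (fun p : Module.End F (Fin n → F) × Module.End F (Fin n → F) =>
    Module.finrank F (LinearMap.ker p.2))]
  · refine Nat.card_congr
      ((Equiv.prodCongr (Matrix.toLinAlgEquiv' (R := F) (n := Fin n)).toEquiv
        (Matrix.toLinAlgEquiv' (R := F) (n := Fin n)).toEquiv).subtypeEquiv fun p => ?_)
    change _ ↔ Matrix.toLinAlgEquiv' p.1 * Matrix.toLinAlgEquiv' p.2 =
      Matrix.toLinAlgEquiv' p.2 * Matrix.toLinAlgEquiv' p.1
    rw [← map_mul, ← map_mul, (Matrix.toLinAlgEquiv').injective.eq_iff]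
  · intro p _
    have := Submodule.finrank_le (LinearMap.ker p.2)
    rw [Module.finrank_fin_fun] at this
    omega

theorem prod_sub_mul_qFactor {q : ℝ} (hq : q ≠ 0) {r s : ℕ} (hs : s ≤ r) :
    (∏ i ∈ Finset.range s, (q ^ r - q ^ i)) * qFactor q⁻¹ (r - s) =
      q ^ (r * s) * qFactor q⁻¹ r := by
  induction s with
  | zero => simp
  | succ s ih =>
    rw [Finset.prod_range_succ, Nat.mul_succ, pow_add, mul_right_comm (q ^ (r * s)),
      ← ih (by omega)]
    obtain ⟨d, rfl⟩ : ∃ d, r = s + 1 + d := ⟨r - (s + 1), by omega⟩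
    have h₁ : s + 1 + d - (s + 1) = d := by omega
    have h₂ : s + 1 + d - s = d + 1 := by omega
    rw [h₁, h₂, qFactor_succ]
    have : q ^ (s + 1 + d) - q ^ s = q ^ (s + 1 + d) * (1 - q⁻¹ ^ (d + 1)) := by
      have h : q ^ (s + 1 + d) = q ^ s * q ^ (d + 1) := by ring
      rw [mul_sub, mul_one, h, mul_assoc, ← mul_pow, mul_inv_cancel₀ hq, one_pow, mul_one]
    rw [this]
    ring

theorem glOrder_add (q n r : ℕ) :
    glOrder q (n + r) = (∏ i ∈ Finset.range r, ((q : ℝ) ^ (n + r) - (q : ℝ) ^ i)) *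
      ((q : ℝ) ^ (n * r) * glOrder q n) := by
  rw [glOrder, add_comm n r, Finset.prod_range_add, glOrder, mul_comm n r, pow_mul]
  congr 1
  rw [← Finset.card_range n, ← Finset.prod_const, Finset.card_range, ← Finset.prod_mul_distrib]
  exact Finset.prod_congr rfl fun i _ => by ring

theorem glOrder_pos {q : ℕ} (hq : 1 < q) (n : ℕ) : 0 < glOrder q n :=
  Finset.prod_pos fun _ hi => sub_pos.2
    (pow_lt_pow_right₀ (by exact_mod_cast hq) (Finset.mem_range.1 hi))

theorem cast_prod_sub {q : ℕ} (hq : 1 < q) {N r : ℕ} (h : r ≤ N) :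
    ((∏ i ∈ Finset.range r, (q ^ N - q ^ i) : ℕ) : ℝ) =
      ∏ i ∈ Finset.range r, ((q : ℝ) ^ N - (q : ℝ) ^ i) := by
  rw [Nat.cast_prod]
  refine Finset.prod_congr rfl fun i hi => ?_
  rw [Nat.cast_sub (Nat.pow_le_pow_right hq.le ((Finset.mem_range.1 hi).le.trans h))]
  push_cast
  rfl

theorem numPairs_div_glOrder_rec (F : Type*) [Field F] [Finite F] (n r : ℕ) :
    (numPairs F (Fin (n + r) → F) r : ℝ) / glOrder (Nat.card F) (n + r) =
      ∑ p ∈ Finset.HasAntidiagonal.antidiagonal r,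
        (numPairs F (Fin n → F) p.1 : ℝ) / glOrder (Nat.card F) n *
          (qFactor (Nat.card F : ℝ)⁻¹ p.2)⁻¹ := by
  have hq : 1 < Nat.card F := Finite.one_lt_card
  have h := congrArg (Nat.cast (R := ℝ))
    (numPairs_mul_prod (F := F) (V := Fin (n + r) → F) (n := n) (r := r) (by simp))
  rw [Finset.Nat.sum_antidiagonal_eq_sum_range_succ_mk]
  rw [Nat.cast_mul, Nat.cast_mul, cast_prod_sub hq le_rfl, cast_prod_sub hq (by omega)] at h
  generalize Nat.card F = q at *
  have hq0 : (0 : ℝ) < q := by exact_mod_cast (zero_lt_one.trans hq)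
  have hφ : ∀ m, 0 < qFactor (q : ℝ)⁻¹ m := fun m =>
    qFactor_pos (by positivity) (inv_lt_one_of_one_lt₀ (by exact_mod_cast hq)) m
  have hP : 0 < ∏ i ∈ Finset.range r, ((q : ℝ) ^ r - (q : ℝ) ^ i) := glOrder_pos hq r
  have hP' : 0 < ∏ i ∈ Finset.range r, ((q : ℝ) ^ (n + r) - (q : ℝ) ^ i) :=
    Finset.prod_pos fun _ hi => sub_pos.2
      (pow_lt_pow_right₀ (by exact_mod_cast hq) (by have := Finset.mem_range.1 hi; omega))
  have hgn := glOrder_pos hq n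
  have hPr := prod_sub_mul_qFactor hq0.ne' (le_refl r)
  rw [Nat.sub_self, qFactor, Finset.prod_range_zero, mul_one] at hPr
  rw [glOrder_add, div_eq_iff (by positivity)]
  refine mul_right_cancel₀ hP.ne' (h.trans ?_)
  rw [mul_left_comm, mul_assoc]
  congr 1
  rw [Nat.cast_mul, Nat.cast_sum, Finset.sum_mul, Finset.sum_mul, Finset.sum_mul]
  refine Finset.sum_congr rfl fun s hs => ?_
  have hsr : s ≤ r := by simpa [Nat.lt_succ_iff] using hs
  rcases lt_or_ge n s with hns | hns
  · rw [numPairs_eq_zero (by simp) hns]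
    simp
  · have hPs := prod_sub_mul_qFactor hq0.ne' hsr
    rw [Nat.cast_mul, Nat.cast_mul, cast_prod_sub hq hsr, hPr]
    have e₁ : (q : ℝ) ^ (n * r) = (q : ℝ) ^ (n * r - s * r) * (q : ℝ) ^ (r * s) := by
      rw [← pow_add, mul_comm r s, Nat.sub_add_cancel (Nat.mul_le_mul_right r hns)]
    have e₂ : (n + r) * r - n * r = r * r := by rw [add_mul, Nat.add_sub_cancel_left]
    rw [e₁, e₂]
    have : ∏ i ∈ Finset.range s, ((q : ℝ) ^ r - (q : ℝ) ^ i) =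
        (q : ℝ) ^ (r * s) * qFactor (q : ℝ)⁻¹ r * (qFactor (q : ℝ)⁻¹ (r - s))⁻¹ := by
      rw [← hPs, mul_assoc, mul_inv_cancel₀ (hφ _).ne', mul_one]
    rw [this]
    push_cast
    field_simp

section Classes

variable (F : Type*) [Field F]

/-- Conjugacy of endomorphisms of `Fⁿ`. -/
abbrev endSetoid (n : ℕ) : Setoid (Module.End F (Fin n → F)) :=
  MulAction.orbitRel (ConjAct (Module.End F (Fin n → F))ˣ) (Module.End F (Fin n → F))

variable {F} in
theorem endSetoid_iff {n : ℕ} {B C : Module.End F (Fin n → F)} :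
    endSetoid F n B C ↔ ∃ e : (Fin n → F) ≃ₗ[F] (Fin n → F), ∀ x, e (B x) = C (e x) := by
  rw [Setoid.comm', MulAction.orbitRel_apply]
  constructor
  · rintro ⟨g, hg⟩
    refine ⟨LinearMap.GeneralLinearGroup.generalLinearEquiv F _ (ConjAct.ofConjAct g), fun x => ?_⟩
    change g • B = C at hg
    rw [ConjAct.units_smul_def, Units.mul_inv_eq_iff_eq_mul] at hg
    exact LinearMap.congr_fun hg x
  · rintro ⟨e, he⟩
    refine ⟨ConjAct.toConjAct ((LinearMap.GeneralLinearGroup.generalLinearEquiv F _).symm e), ?_⟩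
    change (_ • B) = _
    rw [ConjAct.units_smul_def, ConjAct.ofConjAct_toConjAct, Units.mul_inv_eq_iff_eq_mul]
    exact LinearMap.ext he

theorem numPairs_zero_div_glOrder [Finite F] (n : ℕ) :
    (numPairs F (Fin n → F) 0 : ℝ) / glOrder (Nat.card F) n =
      Nat.card (Quotient (endSetoid F n)) := by
  classical
  have : Fintype F := Fintype.ofFinite F
  have : Finite (Module.End F (Fin n → F)) := DFunLike.finite _
  have : Finite (ConjAct (Module.End F (Fin n → F))ˣ) :=
    inferInstanceAs (Finite (Module.End F (Fin n → F))ˣ)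
  have : Fintype (ConjAct (Module.End F (Fin n → F))ˣ) := Fintype.ofFinite _
  have : Fintype (Quotient (endSetoid F n)) := Fintype.ofFinite _
  have : ∀ a : ConjAct (Module.End F (Fin n → F))ˣ,
    Fintype (MulAction.fixedBy (Module.End F (Fin n → F)) a) := fun _ => Fintype.ofFinite _
  have h := MulAction.sum_card_fixedBy_eq_card_orbits_mul_card_group
    (ConjAct (Module.End F (Fin n → F))ˣ) (Module.End F (Fin n → F))
  have hg : (Fintype.card (ConjAct (Module.End F (Fin n → F))ˣ) : ℝ) =
      glOrder (Nat.card F) n := by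
    have e : (Module.End F (Fin n → F))ˣ ≃ GL (Fin n) F :=
      (Units.mapEquiv (Matrix.toLinAlgEquiv' (R := F) (n := Fin n)).toMulEquiv).toEquiv.symm
    rw [← Nat.card_eq_fintype_card]
    change ((Nat.card (Module.End F (Fin n → F))ˣ : ℕ) : ℝ) = _
    rw [Nat.card_congr e, Matrix.card_GL_field, ← Nat.card_eq_fintype_card, glOrder,
      ← cast_prod_sub Finite.one_lt_card le_rfl, Finset.prod_range]
  have hp : numPairs F (Fin n → F) 0 = ∑ a : ConjAct (Module.End F (Fin n → F))ˣ,
      Fintype.card (MulAction.fixedBy (Module.End F (Fin n → F)) a) := by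
    rw [← Fintype.card_sigma, ← Nat.card_eq_fintype_card]
    symm
    refine Nat.card_congr (Equiv.ofBijective (fun x => ⟨(x.2.1, (ConjAct.ofConjAct x.1).1), ?_, ?_⟩)
      ⟨?_, ?_⟩)
    · have := x.2.2
      rw [MulAction.mem_fixedBy, ConjAct.units_smul_def, Units.mul_inv_eq_iff_eq_mul] at this
      exact this.symm
    · rw [Submodule.finrank_eq_zero, LinearMap.ker_eq_bot]
      exact (LinearMap.GeneralLinearGroup.generalLinearEquiv F _ (ConjAct.ofConjAct x.1)).injective
    · rintro ⟨a, b, hb⟩ ⟨a', b', hb'⟩ h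
      obtain ⟨h₁, h₂⟩ := Prod.ext_iff.1 (congrArg Subtype.val h)
      obtain rfl : a = a' := Units.ext h₂
      obtain rfl : b = b' := h₁
      rfl
    · rintro ⟨⟨B, C⟩, hcomm, hC⟩
      rw [Submodule.finrank_eq_zero, LinearMap.ker_eq_bot] at hC
      let e := LinearEquiv.ofInjectiveEndo C hC
      let g := (LinearMap.GeneralLinearGroup.generalLinearEquiv F _).symm e
      have hg : g.1 = C := rfl
      refine ⟨⟨ConjAct.toConjAct g, B, ?_⟩, rfl⟩
      rw [MulAction.mem_fixedBy, ConjAct.units_smul_def, Units.mul_inv_eq_iff_eq_mul]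
      exact hcomm.symm
  have hn := glOrder_pos (Finite.one_lt_card (α := F)) n
  rw [← hp, ← Nat.card_eq_fintype_card (α := Quotient _)] at h
  rw [div_eq_iff hn.ne', h, Nat.cast_mul, hg]

end Classes

section EndSimilar

open Polynomial

universe u v w

variable {F : Type u} [Field F] {V : Type v} [AddCommGroup V] [Module F V]
  {W : Type w} [AddCommGroup W] [Module F W]

/-- Similarity of endomorphisms of possibly different vector spaces. -/
def EndSimilar (B : Module.End F V) (C : Module.End F W) : Prop :=
  ∃ e : V ≃ₗ[F] W, ∀ x, e (B x) = C (e x)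

theorem EndSimilar.refl (B : Module.End F V) : EndSimilar B B := ⟨LinearEquiv.refl F V, fun _ => rfl⟩

theorem EndSimilar.symm {B : Module.End F V} {C : Module.End F W} (h : EndSimilar B C) :
    EndSimilar C B := by
  obtain ⟨e, he⟩ := h
  exact ⟨e.symm, fun x => e.injective (by rw [he, e.apply_symm_apply, e.apply_symm_apply])⟩

theorem EndSimilar.trans {V' : Type*} [AddCommGroup V'] [Module F V'] {A : Module.End F V'}
    {B : Module.End F V} {C : Module.End F W} (h : EndSimilar A B) (h' : EndSimilar B C) :
    EndSimilar A C := by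
  obtain ⟨e, he⟩ := h
  obtain ⟨e', he'⟩ := h'
  exact ⟨e.trans e', fun x => by simp [he, he']⟩

theorem endSimilar_conj (B : Module.End F V) (e : V ≃ₗ[F] W) : EndSimilar (e.conj B) B :=
  EndSimilar.symm ⟨e, fun x => by simp [LinearEquiv.conj_apply_apply]⟩

theorem EndSimilar.prodMap {Q : Type*} [AddCommGroup Q] [Module F Q] (A : Module.End F Q)
    {B : Module.End F V} {C : Module.End F W} (h : EndSimilar B C) :
    EndSimilar (LinearMap.prodMap A B : Module.End F (Q × V)) (LinearMap.prodMap A C) := by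
  obtain ⟨e, he⟩ := h
  exact ⟨(LinearEquiv.refl F Q).prodCongr e, fun x => Prod.ext rfl (he x.2)⟩

theorem EndSimilar.minpoly_eq {B : Module.End F V} {C : Module.End F W} (h : EndSimilar B C) :
    minpoly F B = minpoly F C := by
  obtain ⟨e, he⟩ := h
  have : e.conjAlgEquiv F B = C := LinearMap.ext fun x => by
    obtain ⟨y, rfl⟩ := e.surjective x
    simp [he]
  rw [← this, minpoly.algEquiv_eq]

theorem endSimilar_iff_nonempty_aeval {B : Module.End F V} {C : Module.End F W} :
    EndSimilar B C ↔ Nonempty (Module.AEval' B ≃ₗ[F[X]] Module.AEval' C) := by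
  constructor
  · rintro ⟨e, he⟩
    refine ⟨LinearEquiv.ofAEval B (e.trans (Module.AEval'.of C)) fun x => ?_⟩
    rw [LinearEquiv.trans_apply, LinearEquiv.trans_apply, Module.AEval'.X_smul_of]
    exact congrArg (Module.AEval'.of C) (he x)
  · rintro ⟨e⟩
    refine ⟨(Module.AEval'.of B).trans ((e.restrictScalars F).trans (Module.AEval'.of C).symm),
      fun x => (Module.AEval'.of C).injective ?_⟩
    simp [← Module.AEval'.X_smul_of]

theorem nonempty_aeval_prodMap {Q : Type*} [AddCommGroup Q] [Module F Q] (A : Module.End F Q)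
    (B : Module.End F V) :
    Nonempty (Module.AEval' (LinearMap.prodMap A B : Module.End F (Q × V)) ≃ₗ[F[X]]
      (Module.AEval' A × Module.AEval' B)) :=
  ⟨LinearEquiv.ofAEval (LinearMap.prodMap A B : Module.End F (Q × V))
    ((Module.AEval'.of A).prodCongr (Module.AEval'.of B)) fun _ =>
      Prod.ext (Module.AEval'.X_smul_of A _).symm (Module.AEval'.X_smul_of B _).symm⟩

theorem EndSimilar.of_prodMap {Q M N : Type w} [AddCommGroup Q] [Module F Q] [AddCommGroup M]
    [Module F M] [AddCommGroup N] [Module F N] [Finite Q] [Finite M] [Finite N]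
    {A : Module.End F Q} {B : Module.End F M} {C : Module.End F N}
    (h : EndSimilar (LinearMap.prodMap A B : Module.End F (Q × M))
      (LinearMap.prodMap A C : Module.End F (Q × N))) : EndSimilar B C := by
  obtain ⟨e⟩ := endSimilar_iff_nonempty_aeval.1 h
  obtain ⟨e₁⟩ := nonempty_aeval_prodMap A B
  obtain ⟨e₂⟩ := nonempty_aeval_prodMap A C
  have : Finite (Module.AEval' A) := Finite.of_equiv _ (Module.AEval'.of A).toEquiv
  have : Finite (Module.AEval' B) := Finite.of_equiv _ (Module.AEval'.of B).toEquiv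
  have : Finite (Module.AEval' C) := Finite.of_equiv _ (Module.AEval'.of C).toEquiv
  exact endSimilar_iff_nonempty_aeval.2 (nonempty_linearEquiv_of_prod (e₁.symm.trans (e.trans e₂)))

/-- Multiplication by the root in `F[X]/(f)`. -/
noncomputable def mulRoot (f : F[X]) : Module.End F (AdjoinRoot f) :=
  Algebra.lmul F (AdjoinRoot f) (AdjoinRoot.root f)

theorem minpoly_mulRoot {f : F[X]} (hf : f.Monic) : minpoly F (mulRoot f) = f := by
  rw [mulRoot, minpoly.algHom_eq _ Algebra.lmul_injective, AdjoinRoot.minpoly_root hf.ne_zero,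
    hf.leadingCoeff, inv_one, C_1, mul_one]

theorem aeval_prodMap (A : Module.End F V) (B : Module.End F W) (p : F[X]) :
    aeval (LinearMap.prodMap A B : Module.End F (V × W)) p =
      LinearMap.prodMap (aeval A p) (aeval B p) := by
  have := aeval_algHom_apply (LinearMap.prodMapAlgHom F V W) (A, B) p
  rw [aeval_prod_apply] at this
  exact this

theorem minpoly_prodMap [FiniteDimensional F V] [FiniteDimensional F W] {A : Module.End F V}
    {B : Module.End F W} (h : minpoly F B ∣ minpoly F A) :
    minpoly F (LinearMap.prodMap A B : Module.End F (V × W)) = minpoly F A := by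
  refine Polynomial.eq_of_monic_of_associated (minpoly.monic (Algebra.IsIntegral.isIntegral _))
    (minpoly.monic (Algebra.IsIntegral.isIntegral _)) (associated_of_dvd_dvd ?_ ?_)
  · refine minpoly.dvd F _ ?_
    rw [aeval_prodMap, minpoly.aeval, (minpoly.dvd_iff).1 h]
    rfl
  · refine minpoly.dvd F _ (LinearMap.ext fun x => ?_)
    have := aeval_prodMap A B (minpoly F (LinearMap.prodMap A B : Module.End F (V × W)))
    rw [minpoly.aeval] at this
    exact (congrArg Prod.fst (LinearMap.congr_fun this (x, 0))).symm

theorem minpoly_dvd_minpoly_prodMap (A : Module.End F V) (B : Module.End F W) :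
    minpoly F B ∣ minpoly F (LinearMap.prodMap A B : Module.End F (V × W)) := by
  refine minpoly.dvd F _ (LinearMap.ext fun x => ?_)
  have := aeval_prodMap A B (minpoly F (LinearMap.prodMap A B : Module.End F (V × W)))
  rw [minpoly.aeval] at this
  exact (congrArg Prod.snd (LinearMap.congr_fun this (0, x))).symm

end EndSimilar

section Cyclic

open Polynomial

variable {F : Type*} [Field F] {V : Type*} [AddCommGroup V] [Module F V]

/-- The `F`-linear map sending the class of `p` modulo the minimal polynomial of `B` to `p(B)`. -/
noncomputable def adjoinRootAeval (B : Module.End F V) :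
    AdjoinRoot (minpoly F B) →ₐ[F] Module.End F V :=
  Ideal.Quotient.liftₐ (Ideal.span {minpoly F B}) (aeval B) fun p hp => by
    rw [Ideal.mem_span_singleton] at hp
    exact (minpoly.dvd_iff).1 hp

theorem adjoinRootAeval_mk (B : Module.End F V) (p : F[X]) :
    adjoinRootAeval B (AdjoinRoot.mk _ p) = aeval B p := rfl

theorem adjoinRootAeval_root (B : Module.End F V) :
    adjoinRootAeval B (AdjoinRoot.root _) = B :=
  (adjoinRootAeval_mk B X).trans (aeval_X B)

/-- There is a vector whose annihilator is generated by the minimal polynomial. -/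
theorem exists_injective_adjoinRootAeval [FiniteDimensional F V] (B : Module.End F V) :
    ∃ v : V, ∀ a, adjoinRootAeval B a v = 0 → a = 0 := by
  obtain ⟨x, hx⟩ := Module.exists_ker_toSpanSingleton_eq_annihilator F[X] (Module.AEval' B)
  obtain ⟨v, rfl⟩ := (Module.AEval'.of B).surjective x
  refine ⟨v, fun a ha => ?_⟩
  obtain ⟨p, rfl⟩ := AdjoinRoot.mk_surjective a
  rw [adjoinRootAeval_mk] at ha
  rw [AdjoinRoot.mk_eq_zero, ← Ideal.mem_span_singleton, Polynomial.span_minpoly_eq_annihilator,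
    ← hx, LinearMap.mem_ker, LinearMap.toSpanSingleton_apply]
  have : p • Module.AEval'.of B v = Module.AEval'.of B (aeval B p v) := rfl
  rw [this, ha, map_zero]

/-- The algebra `F[X]/(f)` has a linear form with no nonzero ideal in its kernel. -/
theorem exists_nondegenerate_form {f : F[X]} (hf : f.Monic) :
    ∃ l : AdjoinRoot f →ₗ[F] F, ∀ b, (∀ a, l (a * b) = 0) → b = 0 := by
  refine ⟨lcoeff F (f.natDegree - 1) ∘ₗ AdjoinRoot.modByMonicHom hf, fun b hb => ?_⟩
  by_contra hb0
  obtain ⟨p, hp⟩ : ∃ p, p = AdjoinRoot.modByMonicHom hf b := ⟨_, rfl⟩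
  have hpb : AdjoinRoot.mk f p = b := by rw [hp, AdjoinRoot.mk_leftInverse hf b]
  have hp0 : p ≠ 0 := by
    rintro rfl
    exact hb0 (by rw [← hpb, map_zero])
  have hf1 : f ≠ 1 := by
    rintro rfl
    refine hb0 ?_
    rw [← hpb, AdjoinRoot.mk_eq_zero]
    exact one_dvd p
  have hdeg : p.natDegree < f.natDegree := by
    rw [hp, ← AdjoinRoot.mk_leftInverse hf b, AdjoinRoot.mk_leftInverse hf b]
    obtain ⟨g, rfl⟩ := AdjoinRoot.mk_surjective b
    rw [AdjoinRoot.modByMonicHom_mk]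
    exact natDegree_modByMonic_lt g hf hf1
  have h := hb (AdjoinRoot.mk f (X ^ (f.natDegree - 1 - p.natDegree)))
  rw [← hpb, ← map_mul, LinearMap.comp_apply, AdjoinRoot.modByMonicHom_mk,
    (modByMonic_eq_self_iff hf).2, lcoeff_apply, coeff_X_pow_mul', if_pos (by omega)] at h
  · rw [show f.natDegree - 1 - (f.natDegree - 1 - p.natDegree) = p.natDegree by omega] at h
    exact hp0 (leadingCoeff_eq_zero.1 h)
  · refine degree_lt_degree ?_
    rw [natDegree_X_pow_mul _ hp0]
    omega

/-- Rational canonical form, one step: the companion block of the minimal polynomial splits off. -/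
theorem exists_endSimilar_prodMap [FiniteDimensional F V] (B : Module.End F V) :
    ∃ (U : Submodule F V) (D : Module.End F U),
      EndSimilar (LinearMap.prodMap (mulRoot (minpoly F B)) D :
        Module.End F (AdjoinRoot (minpoly F B) × U)) B := by
  have hf : (minpoly F B).Monic := minpoly.monic (Algebra.IsIntegral.isIntegral _)
  have : FiniteDimensional F (AdjoinRoot (minpoly F B)) := hf.finite_adjoinRoot
  obtain ⟨v, hv⟩ := exists_injective_adjoinRootAeval B
  obtain ⟨l, hl⟩ := exists_nondegenerate_form hf
  let ι : AdjoinRoot (minpoly F B) →ₗ[F] V :=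
    LinearMap.applyₗ v ∘ₗ (adjoinRootAeval B).toLinearMap
  have hι : ∀ a, ι a = adjoinRootAeval B a v := fun _ => rfl
  obtain ⟨g, hg⟩ := ι.exists_leftInverse_of_injective ((Submodule.eq_bot_iff _).2 hv)
  let T : V →ₗ[F] Module.Dual F (AdjoinRoot (minpoly F B)) :=
    LinearMap.mk₂ F (fun u a => l (g (adjoinRootAeval B a u))) (fun _ _ _ => by simp)
      (fun _ _ _ => by simp) (fun _ _ _ => by simp) fun _ _ _ => by simp
  have hT : ∀ u a, T u a = l (g (adjoinRootAeval B a u)) := fun _ _ => rfl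
  have hTι : Function.Injective (T ∘ₗ ι) := by
    rw [← LinearMap.ker_eq_bot, Submodule.eq_bot_iff]
    intro b hb
    refine hl b fun a => ?_
    have h := LinearMap.congr_fun hb a
    rw [LinearMap.comp_apply, hT, hι, ← Module.End.mul_apply, ← map_mul, ← hι] at h
    exact (congrArg l (LinearMap.congr_fun hg (a * b))).symm.trans h
  have hTι' := (LinearMap.injective_iff_surjective_of_finrank_eq_finrank
    Subspace.dual_finrank_eq.symm).1 hTι
  have hBU : ∀ u ∈ LinearMap.ker T, B u ∈ LinearMap.ker T := fun u hu => by
    rw [LinearMap.mem_ker] at hu ⊢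
    refine LinearMap.ext fun a => ?_
    have h := LinearMap.congr_fun hu (a * AdjoinRoot.root _)
    rwa [hT, map_mul, adjoinRootAeval_root] at h
  refine ⟨LinearMap.ker T, B.restrict hBU,
    LinearEquiv.ofBijective (ι.coprod (LinearMap.ker T).subtype) ⟨?_, ?_⟩, fun x => ?_⟩
  · rw [← LinearMap.ker_eq_bot, Submodule.eq_bot_iff]
    rintro ⟨a, u, hu⟩ h
    rw [LinearMap.mem_ker, LinearMap.coprod_apply, Submodule.subtype_apply] at h
    have ha : (T ∘ₗ ι) a = (T ∘ₗ ι) 0 := by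
      have := congrArg T h
      rw [map_add, LinearMap.mem_ker.1 hu, add_zero, map_zero] at this
      rw [map_zero]
      exact this
    obtain rfl := hTι ha
    rw [map_zero, zero_add] at h
    exact Prod.ext rfl (Subtype.ext h)
  · intro w
    obtain ⟨a, ha⟩ := hTι' (T w)
    exact ⟨(a, ⟨w - ι a, by rw [LinearMap.mem_ker, map_sub, ← ha]; exact sub_self _⟩), by simp⟩
  · change ι (AdjoinRoot.root _ * x.1) + B x.2 = B (ι x.1 + x.2)
    rw [map_add, hι, map_mul, adjoinRootAeval_root]
    rfl

end Cyclic

section MonicCount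

open Polynomial

variable (F : Type*) [Field F]

/-- Monic polynomials of degree `m`. -/
abbrev MonicOfDegree (m : ℕ) : Type _ := {f : F[X] // f.Monic ∧ f.natDegree = m}

/-- A monic polynomial of degree `m` is determined by its lower coefficients. -/
noncomputable def monicOfDegreeEquiv (m : ℕ) : MonicOfDegree F m ≃ (Fin m → F) :=
  Equiv.trans (β := degreeLT F m)
    { toFun := fun f => ⟨f.1 - X ^ m, mem_degreeLT.2 <| by
        have h := degree_eq_natDegree f.2.1.ne_zero
        rw [f.2.2] at h
        rw [← h]
        exact degree_sub_lt_left (by rw [h, degree_X_pow]) f.2.1.ne_zero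
          (by rw [f.2.1.leadingCoeff, (monic_X_pow m).leadingCoeff])⟩
      invFun := fun p => ⟨X ^ m + p.1, monic_X_pow_add (mem_degreeLT.1 p.2),
        natDegree_eq_of_degree_eq_some <| by
          rw [degree_add_eq_left_of_degree_lt, degree_X_pow]
          rw [degree_X_pow]
          exact mem_degreeLT.1 p.2⟩
      left_inv := fun f => Subtype.ext (by simp)
      right_inv := fun p => Subtype.ext (by simp) }
    (degreeLTEquiv F m).toEquiv

instance [Finite F] (m : ℕ) : Finite (MonicOfDegree F m) :=
  Finite.of_equiv _ (monicOfDegreeEquiv F m).symm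

theorem card_monicOfDegree (m : ℕ) : Nat.card (MonicOfDegree F m) = Nat.card F ^ m := by
  rw [Nat.card_congr (monicOfDegreeEquiv F m), Nat.card_fun, Nat.card_fin]

variable {F} in
theorem card_monicOfDegree_dvd {g : F[X]} (hg : g.Monic) {k : ℕ} (hk : g.natDegree ≤ k) :
    Nat.card {f : MonicOfDegree F k // g ∣ f.1} = Nat.card F ^ (k - g.natDegree) := by
  rw [← card_monicOfDegree]
  refine (Nat.card_congr (Equiv.ofBijective (fun h => ⟨⟨g * h.1, hg.mul h.2.1, by
    rw [hg.natDegree_mul h.2.1, h.2.2]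
    omega⟩, dvd_mul_right _ _⟩) ⟨?_, ?_⟩)).symm
  · intro h h' heq
    exact Subtype.ext (mul_left_cancel₀ hg.ne_zero (congrArg (fun x => x.1.1) heq))
  · rintro ⟨⟨f, hf, hfk⟩, hgf⟩
    obtain ⟨h, hgh⟩ : ∃ h, f = g * h := hgf
    subst hgh
    have hh : h.Monic := hg.of_mul_monic_left hf
    refine ⟨⟨h, hh, ?_⟩, rfl⟩
    rw [hg.natDegree_mul hh] at hfk
    omega

end MonicCount

section ClassCount

open Polynomial

variable {F : Type*} [Field F]

theorem endSetoid_iff_endSimilar {n : ℕ} {B C : Module.End F (Fin n → F)} :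
    endSetoid F n B C ↔ EndSimilar B C := endSetoid_iff

/-- The minimal polynomial of a conjugacy class. -/
noncomputable def classMinpoly {n : ℕ} (c : Quotient (endSetoid F n)) : F[X] :=
  Quotient.liftOn c (minpoly F) fun _ _ h => (endSetoid_iff_endSimilar.1 h).minpoly_eq

theorem classMinpoly_eq {n : ℕ} (c : Quotient (endSetoid F n)) :
    classMinpoly c = minpoly F c.out := by
  conv_lhs => rw [← c.out_eq]
  rfl

theorem monic_classMinpoly {n : ℕ} (c : Quotient (endSetoid F n)) : (classMinpoly c).Monic := by
  rw [classMinpoly_eq]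
  exact minpoly.monic (Algebra.IsIntegral.isIntegral _)

/-- The conjugacy class of matrices representing an endomorphism. -/
noncomputable def endClass {V : Type*} [AddCommGroup V] [Module F V] [FiniteDimensional F V]
    {n : ℕ} (h : Module.finrank F V = n) (B : Module.End F V) : Quotient (endSetoid F n) :=
  Quotient.mk _ ((Module.finBasisOfFinrankEq F V h).equivFun.conj B)

theorem endSimilar_out_endClass {V : Type*} [AddCommGroup V] [Module F V] [FiniteDimensional F V]
    {n : ℕ} (h : Module.finrank F V = n) (B : Module.End F V) :
    EndSimilar (endClass h B).out B :=
  (endSetoid_iff_endSimilar.1 (Quotient.exact (Quotient.out_eq (endClass h B)))).trans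
    (endSimilar_conj B _)

theorem eq_of_endSimilar_out {n : ℕ} {c d : Quotient (endSetoid F n)}
    (h : EndSimilar c.out d.out) : c = d := by
  rw [← c.out_eq, ← d.out_eq]
  exact Quotient.sound (endSetoid_iff_endSimilar.2 h)

variable (F) in
/-- The number of conjugacy classes of `n × n` matrices with minimal polynomial of degree `k`. -/
noncomputable def numClasses (n k : ℕ) : ℕ :=
  Nat.card {c : Quotient (endSetoid F n) // (classMinpoly c).natDegree = k}

theorem natDegree_classMinpoly_le {n : ℕ} (c : Quotient (endSetoid F n)) :
    (classMinpoly c).natDegree ≤ n := by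
  rw [classMinpoly_eq]
  refine (natDegree_le_of_dvd (LinearMap.minpoly_dvd_charpoly _)
    (LinearMap.charpoly_monic _).ne_zero).trans ?_
  rw [LinearMap.charpoly_natDegree, Module.finrank_fin_fun]

theorem numClasses_eq_zero {n k : ℕ} (h : n < k) : numClasses F n k = 0 := by
  have : IsEmpty {c : Quotient (endSetoid F n) // (classMinpoly c).natDegree = k} :=
    ⟨fun c => by have := natDegree_classMinpoly_le c.1; have := c.2; omega⟩
  exact Nat.card_of_isEmpty

theorem card_quotient_endSetoid [Finite F] (n : ℕ) :
    Nat.card (Quotient (endSetoid F n)) = ∑ k ∈ Finset.range (n + 1), numClasses F n k := by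
  have : Finite (Module.End F (Fin n → F)) := DFunLike.finite _
  have h := card_subtype_eq_sum (p := fun _ : Quotient (endSetoid F n) => True)
    (fun c => (classMinpoly c).natDegree) (m := n + 1)
    fun c _ => Nat.lt_succ_of_le (natDegree_classMinpoly_le c)
  simp only [true_and] at h
  unfold numClasses
  rw [← h]
  exact (Nat.card_congr (Equiv.subtypeUnivEquiv fun _ => trivial)).symm

theorem numClasses_zero_right (n : ℕ) : numClasses F n 0 = if n = 0 then 1 else 0 := by
  split_ifs with hn
  · subst hn
    have : Subsingleton (Module.End F (Fin 0 → F)) := inferInstance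
    refine Nat.card_eq_one_iff_unique.2 ⟨⟨fun c d => Subtype.ext ?_⟩,
      ⟨⟨endClass (by simp) (0 : Module.End F (Fin 0 → F)), ?_⟩⟩⟩
    · refine eq_of_endSimilar_out ?_
      rw [Subsingleton.elim c.1.out d.1.out]
      exact EndSimilar.refl _
    · exact Nat.le_zero.1 (natDegree_classMinpoly_le _)
  · have : NeZero n := ⟨hn⟩
    have : IsEmpty {c : Quotient (endSetoid F n) // (classMinpoly c).natDegree = 0} := by
      refine ⟨fun c => ?_⟩
      have h := c.2
      rw [classMinpoly_eq] at h
      exact (minpoly.natDegree_pos (Algebra.IsIntegral.isIntegral _)).ne' h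
    exact Nat.card_of_isEmpty

theorem finrank_adjoinRoot {f : F[X]} (hf : f.Monic) :
    Module.finrank F (AdjoinRoot f) = f.natDegree :=
  (AdjoinRoot.powerBasis' hf).finrank.trans (AdjoinRoot.powerBasis'_dim hf)

theorem finiteDimensional_adjoinRoot {f : F[X]} (hf : f.Monic) :
    FiniteDimensional F (AdjoinRoot f) := hf.finite_adjoinRoot

/-- Conjugacy classes are built by adding a companion block of the minimal polynomial. -/
theorem card_dvd_eq_numClasses [Finite F] (n k : ℕ) :
    Nat.card {x : Quotient (endSetoid F n) × MonicOfDegree F k // classMinpoly x.1 ∣ x.2.1} =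
      numClasses F (n + k) k := by
  have hfin : ∀ f : MonicOfDegree F k, FiniteDimensional F (AdjoinRoot f.1) :=
    fun f => finiteDimensional_adjoinRoot f.2.1
  have hrank : ∀ f : MonicOfDegree F k,
      Module.finrank F (AdjoinRoot f.1 × (Fin n → F)) = n + k := fun f => by
    rw [Module.finrank_prod, finrank_adjoinRoot f.2.1, f.2.2, Module.finrank_fin_fun, add_comm]
  let Φ : Quotient (endSetoid F n) × MonicOfDegree F k → Quotient (endSetoid F (n + k)) :=
    fun x => endClass (hrank x.2) (LinearMap.prodMap (mulRoot x.2.1) x.1.out)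
  have hΦ : ∀ x, EndSimilar (Φ x).out (LinearMap.prodMap (mulRoot x.2.1) x.1.out :
      Module.End F (AdjoinRoot x.2.1 × (Fin n → F))) := fun x => endSimilar_out_endClass _ _
  have hmin : ∀ x, classMinpoly x.1 ∣ x.2.1 → classMinpoly (Φ x) = x.2.1 := fun x hx => by
    rw [classMinpoly_eq, (hΦ x).minpoly_eq, minpoly_prodMap, minpoly_mulRoot x.2.2.1]
    rwa [minpoly_mulRoot x.2.2.1, ← classMinpoly_eq]
  refine Nat.card_congr (Equiv.ofBijective
    (fun x => ⟨Φ x.1, by rw [hmin x.1 x.2, x.1.2.2.2]⟩) ⟨?_, ?_⟩)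
  · rintro ⟨⟨c, f⟩, hx⟩ ⟨⟨d, f'⟩, hy⟩ h
    have h' : Φ (c, f) = Φ (d, f') := congrArg Subtype.val h
    obtain rfl : f = f' := Subtype.ext (by rw [← hmin (c, f) hx, h', hmin (d, f') hy])
    have hsim := (hΦ (c, f)).symm.trans (h' ▸ hΦ (d, f))
    have : Finite (AdjoinRoot f.1) := Module.finite_of_finite F
    exact Subtype.ext (Prod.ext (eq_of_endSimilar_out hsim.of_prodMap) rfl)
  · rintro ⟨b, hb⟩
    obtain ⟨U, D, hD⟩ := exists_endSimilar_prodMap b.out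
    have hf := monic_classMinpoly b
    rw [classMinpoly_eq] at hb hf
    have := finiteDimensional_adjoinRoot hf
    have hU : Module.finrank F U = n := by
      obtain ⟨e, -⟩ := hD
      have := e.finrank_eq
      rw [Module.finrank_prod, finrank_adjoinRoot hf, hb, Module.finrank_fin_fun] at this
      omega
    have hsim := (EndSimilar.prodMap (mulRoot (minpoly F b.out))
      (endSimilar_out_endClass hU D)).trans hD
    refine ⟨⟨(endClass hU D, ⟨minpoly F b.out, hf, hb⟩), ?_⟩,
      Subtype.ext (eq_of_endSimilar_out ((hΦ _).trans hsim))⟩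
    rw [classMinpoly_eq]
    have h := minpoly_dvd_minpoly_prodMap (mulRoot (minpoly F b.out)) (endClass hU D).out
    rwa [hsim.minpoly_eq] at h

theorem numClasses_rec [Finite F] (n k : ℕ) :
    numClasses F (n + k) k = ∑ p ∈ Finset.HasAntidiagonal.antidiagonal k,
      numClasses F n p.1 * Nat.card F ^ p.2 := by
  have : Finite (Module.End F (Fin n → F)) := DFunLike.finite _
  rw [Finset.Nat.sum_antidiagonal_eq_sum_range_succ_mk, ← card_dvd_eq_numClasses,
    card_subtype_eq_sum (fun x => (classMinpoly x.1).natDegree) (m := k + 1)]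
  · refine Finset.sum_congr rfl fun j hj => ?_
    have h := card_subtype_prod_eq_mul
      (p := fun c : Quotient (endSetoid F n) => (classMinpoly c).natDegree = j)
      (r := fun c (f : MonicOfDegree F k) => classMinpoly c ∣ f.1) (c := Nat.card F ^ (k - j))
      fun c hc => by
        rw [card_monicOfDegree_dvd (monic_classMinpoly c)
          (by rw [hc]; exact Nat.lt_succ_iff.1 (Finset.mem_range.1 hj)), hc]
    rw [numClasses, ← h]
    exact Nat.card_congr (Equiv.subtypeEquivRight fun x => and_comm)
  · intro x hx
    have := natDegree_le_of_dvd hx x.2.2.1.ne_zero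
    rw [x.2.2.2] at this
    omega

end ClassCount

section FeitFine

theorem hasSum_of_conv_of_nonneg {a : ℕ → ℕ → ℝ} {e : ℕ → ℝ} (ha0 : ∀ n r, 0 ≤ a n r)
    (he : ∀ m, 0 ≤ e m) (ha : ∀ n r, n < r → a n r = 0)
    (hrec : ∀ n r, a (n + r) r =
      ∑ p ∈ Finset.HasAntidiagonal.antidiagonal r, a n p.1 * e p.2)
    (he0 : e 0 = 1) {t : ℝ} (ht0 : 0 ≤ t) (ht : t < 1)
    (hs : ∀ i, Summable fun m => e m * (t ^ (i + 1)) ^ m) {A₀ : ℝ}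
    (hA : HasSum (fun n => a n 0 * t ^ n) A₀) :
    Multipliable (fun i => ∑' m, e m * (t ^ (i + 1)) ^ m) ∧
    HasSum (fun n => (∑ r ∈ Finset.range (n + 1), a n r) * t ^ n)
      (A₀ * ∏' i, ∑' m, e m * (t ^ (i + 1)) ^ m) := by
  have hA₀ : 0 ≤ A₀ := hA.nonneg fun n => mul_nonneg (ha0 n 0) (pow_nonneg ht0 n)
  lift a to ℕ → ℕ → ℝ≥0 using ha0
  lift e to ℕ → ℝ≥0 using he
  lift t to ℝ≥0 using ht0
  lift A₀ to ℝ≥0 using hA₀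
  beta_reduce at ha hrec he0 hs hA ⊢
  have he0' : e 0 = 1 := by exact_mod_cast he0
  have ht' : t < 1 := by exact_mod_cast ht
  have hs' : ∀ i, Summable fun m => e m * (t ^ (i + 1)) ^ m := fun i => by
    rw [← NNReal.summable_coe]
    simpa using hs i
  have hmul := multipliable_tsum_pow he0' ht' hs'
  have key := hasSum_of_conv (a := a) (e := e) (fun n r h => by exact_mod_cast ha n r h)
    (fun n r => NNReal.coe_injective (by push_cast; exact hrec n r)) he0' ht' hs'
    (A₀ := A₀) (by rw [← NNReal.hasSum_coe]; simpa using hA)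
  have hp := hmul.hasProd.map NNReal.toRealHom NNReal.continuous_coe
  have hfun : (NNReal.toRealHom ∘ fun i => ∑' m, e m * (t ^ (i + 1)) ^ m) =
      fun i => ∑' m, (e m : ℝ) * ((t : ℝ) ^ (i + 1)) ^ m := by
    funext i
    simp [NNReal.coe_tsum]
  rw [hfun] at hp
  refine ⟨hp.multipliable, ?_⟩
  rw [hp.tprod_eq]
  rw [← NNReal.hasSum_coe] at key
  simpa using key

variable (F : Type*) [Field F] [Fintype F]

theorem hasSum_card_quotient_endSetoid {t : ℝ} (ht0 : 0 ≤ t) (ht : t < 1)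
    (hqt : Nat.card F * t < 1) :
    Multipliable (fun i => (1 - (Nat.card F : ℝ) * t ^ (i + 1))⁻¹) ∧
    HasSum (fun n => (Nat.card (Quotient (endSetoid F n)) : ℝ) * t ^ n)
      (∏' i, (1 - (Nat.card F : ℝ) * t ^ (i + 1))⁻¹) := by
  have hlt : ∀ i : ℕ, (Nat.card F : ℝ) * t ^ (i + 1) < 1 := fun i =>
    (mul_le_mul_of_nonneg_left (pow_le_of_le_one ht0 ht.le i.succ_ne_zero)
      (Nat.cast_nonneg _)).trans_lt hqt
  have hgeo : ∀ i : ℕ, HasSum (fun m => (Nat.card F : ℝ) ^ m * (t ^ (i + 1)) ^ m)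
      (1 - (Nat.card F : ℝ) * t ^ (i + 1))⁻¹ := fun i => by
    simp_rw [← mul_pow]
    exact hasSum_geometric_of_lt_one (by positivity) (hlt i)
  have hA : HasSum (fun n => (numClasses F n 0 : ℝ) * t ^ n) 1 := by
    have := hasSum_ite_eq (0 : ℕ) (1 : ℝ)
    refine this.congr_fun ?_
    intro n
    rw [numClasses_zero_right]
    by_cases hn : n = 0 <;> simp [hn]
  have key := hasSum_of_conv_of_nonneg (a := fun n r => (numClasses F n r : ℝ))
    (e := fun m => (Nat.card F : ℝ) ^ m) (fun _ _ => Nat.cast_nonneg _)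
    (fun _ => by positivity) (fun n r h => by simp [numClasses_eq_zero h])
    (fun n r => by simp [numClasses_rec]) (pow_zero _) ht0 ht
    (fun i => (hgeo i).summable) hA
  simp_rw [fun i => (hgeo i).tsum_eq, one_mul] at key
  simpa [card_quotient_endSetoid] using key

theorem hasSum_ccount_div_glOrder {t : ℝ} (ht0 : 0 ≤ t) (ht : t < 1)
    (hqt : Nat.card F * t < 1) :
    Multipliable (fun i => ∑' m, (qFactor (Nat.card F : ℝ)⁻¹ m)⁻¹ * (t ^ (i + 1)) ^ m) ∧
    HasSum (fun n => (ccount F n : ℝ) / glOrder (Nat.card F) n * t ^ n)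
      ((∏' i, (1 - (Nat.card F : ℝ) * t ^ (i + 1))⁻¹) *
        ∏' i, ∑' m, (qFactor (Nat.card F : ℝ)⁻¹ m)⁻¹ * (t ^ (i + 1)) ^ m) := by
  have hq : 1 < Nat.card F := Finite.one_lt_card
  have hp0 : 0 ≤ (Nat.card F : ℝ)⁻¹ := by positivity
  have hp1 : (Nat.card F : ℝ)⁻¹ < 1 := inv_lt_one_of_one_lt₀ (by exact_mod_cast hq)
  have key := hasSum_of_conv_of_nonneg
    (a := fun n r => (numPairs F (Fin n → F) r : ℝ) / glOrder (Nat.card F) n)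
    (e := fun m => (qFactor (Nat.card F : ℝ)⁻¹ m)⁻¹)
    (fun n _ => div_nonneg (Nat.cast_nonneg _) (glOrder_pos hq n).le)
    (fun m => inv_nonneg.2 (qFactor_pos hp0 hp1 m).le)
    (fun n r h => by simp [numPairs_eq_zero (F := F) (V := Fin n → F) (by simp) h])
    (fun n r => numPairs_div_glOrder_rec F n r) (by simp [qFactor]) ht0 ht
    (fun i => summable_inv_qFactor_mul_pow hp0 hp1 (by positivity)
      (pow_lt_one₀ ht0 ht i.succ_ne_zero))
    (by
      simp_rw [numPairs_zero_div_glOrder]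
      exact (hasSum_card_quotient_endSetoid F ht0 ht hqt).2)
  refine ⟨key.1, ?_⟩
  simpa [ccount_eq_sum_numPairs, Finset.sum_div] using key.2

theorem hasProd_inv_one_sub_zpow_mul {q x : ℝ} (hq : 1 < q) (hx0 : 0 ≤ x) (hx : x < 1) :
    HasProd (fun j : ℕ => (1 - q ^ (1 - (j : ℤ)) * x)⁻¹)
      ((1 - q * x)⁻¹ * ∑' m, (qFactor q⁻¹ m)⁻¹ * x ^ m) := by
  have h := hasProd_euler (inv_nonneg.2 (zero_le_one.trans hq.le))
    (inv_lt_one_of_one_lt₀ hq) hx0 hx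
  have hshift : (fun j : ℕ => (1 - q⁻¹ ^ j * x)⁻¹) =
      fun j : ℕ => (1 - q ^ (1 - ((j + 1 : ℕ) : ℤ)) * x)⁻¹ := by
    funext j
    rw [show (1 - ((j + 1 : ℕ) : ℤ)) = -(j : ℤ) by push_cast; ring, _root_.zpow_neg, zpow_natCast,
      inv_pow]
  rw [hshift] at h
  simpa using HasProd.zero_mul (f := fun j : ℕ => (1 - q ^ (1 - (j : ℤ)) * x)⁻¹) h

end FeitFine

/-- Feit–Fine: for `0 ≤ t < q^{−2}`, the series `∑ (c_n/g_n) tⁿ`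
converges, the double product `∏_{m≥1} ∏_{j≥0} (1 − q^{1−j} tᵐ)^{−1}` converges
(each inner product, and the outer product of the inner values), and the sum equals
the double product. -/
theorem statement_14 (F : Type*) [Field F] [Fintype F] (q : ℕ)
    (hq : Fintype.card F = q) (t : ℝ) (ht0 : 0 ≤ t) (ht : t < (q : ℝ) ^ (-2 : ℤ)) :
    Summable (fun n : ℕ => (ccount F n : ℝ) / glOrder q n * t ^ n) ∧
    (∀ m : ℕ, 1 ≤ m →
      Multipliable (fun j : ℕ => (1 - (q : ℝ) ^ (1 - (j : ℤ)) * t ^ m)⁻¹)) ∧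
    Multipliable (fun m : ℕ =>
      ∏' j : ℕ, (1 - (q : ℝ) ^ (1 - (j : ℤ)) * t ^ (m + 1))⁻¹) ∧
    (∑' n : ℕ, (ccount F n : ℝ) / glOrder q n * t ^ n) =
      ∏' m : ℕ, ∏' j : ℕ, (1 - (q : ℝ) ^ (1 - (j : ℤ)) * t ^ (m + 1))⁻¹ := by
  subst hq
  rw [← Nat.card_eq_fintype_card] at ht ⊢
  have hq : (1 : ℝ) < Nat.card F := by exact_mod_cast Finite.one_lt_card (α := F)
  have hq0 : (0 : ℝ) < Nat.card F := one_pos.trans hq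
  have hqt : (Nat.card F : ℝ) * t < 1 := by
    refine (mul_lt_mul_of_pos_left ht hq0).trans ?_
    rw [← zpow_one_add₀ hq0.ne']
    exact zpow_lt_one_of_neg₀ hq (by norm_num)
  have ht1 : t < 1 := (le_mul_of_one_le_left ht0 hq.le).trans_lt hqt
  have hinner : ∀ m : ℕ, 1 ≤ m → HasProd
      (fun j : ℕ => (1 - (Nat.card F : ℝ) ^ (1 - (j : ℤ)) * t ^ m)⁻¹) _ := fun m hm =>
    hasProd_inv_one_sub_zpow_mul hq (pow_nonneg ht0 m)
      (pow_lt_one₀ ht0 ht1 (Nat.one_le_iff_ne_zero.1 hm))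
  obtain ⟨hmul, hsum⟩ := hasSum_ccount_div_glOrder F ht0 ht1 hqt
  have houter := (hasSum_card_quotient_endSetoid F ht0 ht1 hqt).1.hasProd.mul hmul.hasProd
  simp_rw [← fun m : ℕ => (hinner (m + 1) m.succ_pos).tprod_eq] at houter
  exact ⟨hsum.summable, fun m hm => (hinner m hm).multipliable, houter.multipliable,
    hsum.tsum_eq.trans houter.tprod_eq.symm⟩
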